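/- The extended Catalan arrangement BCCat of type BC_N is free: the module D(BCCat) of logarithmic vector fields — vector fields L = Σ_{i=1}^N f_i ∂_{x_i} with f_i ∈ ℂ[x_1,…,x_N] such that (x_i − j) divides L(x_i) = f_i for all i and −m_1 ≤ j ≤ m_1, (2x_i − (2j−1)) and (2x_i + (2j−1)) divide f_i for all i and 1 ≤ j ≤ m_2, and (x_i − εx_j − k) divides f_i − εf_j for all i < j, ε ∈ {±1}, −m_3 ≤ k ≤ m_3 — is a free ℂ[x_1,…,x_N]-module of rank N; moreover the module D(BCCat)^W of W(B_N)-invariant elements of D(BCCat) is a free module of rank N over the invariant ring ℂ[x_1,…,x_N]^{W(B_N)}. -/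

import Mathlib

open MvPolynomial

noncomputable section

/-- Substitution `x ↦ x + v` on polynomials. -/
def shiftPoly {n : ℕ} (v : Fin n → ℂ) (p : MvPolynomial (Fin n) ℂ) :
    MvPolynomial (Fin n) ℂ :=
  MvPolynomial.aeval (fun i => MvPolynomial.X i + MvPolynomial.C (v i)) p

/-- `σ_j`: negation of the `j`-th coordinate. -/
def sigmaP {n : ℕ} (j : Fin n) (p : MvPolynomial (Fin n) ℂ) : MvPolynomial (Fin n) ℂ :=
  MvPolynomial.aeval
    (fun k => if k = j then -(MvPolynomial.X j) else (MvPolynomial.X k : MvPolynomial (Fin n) ℂ)) p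

/-- `τ_{ij}`: transposition of the `i`-th and `j`-th coordinates. -/
def swapP {n : ℕ} (i j : Fin n) (p : MvPolynomial (Fin n) ℂ) : MvPolynomial (Fin n) ℂ :=
  MvPolynomial.aeval
    (fun k => if k = i then MvPolynomial.X j
      else if k = j then MvPolynomial.X i else (MvPolynomial.X k : MvPolynomial (Fin n) ℂ)) p

/-- `ρ_{ij}`: swap of the `i`-th and `j`-th coordinates combined with negating both. -/
def rhoP {n : ℕ} (i j : Fin n) (p : MvPolynomial (Fin n) ℂ) : MvPolynomial (Fin n) ℂ :=
  MvPolynomial.aeval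
    (fun k => if k = i then -(MvPolynomial.X j)
      else if k = j then -(MvPolynomial.X i) else (MvPolynomial.X k : MvPolynomial (Fin n) ℂ)) p

/-- The trigonometric quasi-invariants of type `BC_N`. -/
def QtrBC (N : ℕ) (m1 m2 m3 : ℕ) : Set (MvPolynomial (Fin N) ℂ) :=
  {p | (∀ j : Fin N, ∀ s : ℕ, 1 ≤ s → s ≤ m1 →
          MvPolynomial.X j ∣
            shiftPoly (Pi.single j ((s : ℂ))) p - shiftPoly (Pi.single j (-(s : ℂ))) p) ∧
       (∀ j : Fin N, ∀ s : ℕ, 1 ≤ s → s ≤ m2 →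
          MvPolynomial.X j ∣
            shiftPoly (Pi.single j ((s : ℂ) - 1/2)) p
              - shiftPoly (Pi.single j (-((s : ℂ) - 1/2))) p) ∧
       (∀ i j : Fin N, i ≠ j → ∀ s : ℕ, 1 ≤ s → s ≤ m3 →
          ((MvPolynomial.X i - MvPolynomial.X j) ∣
            shiftPoly (Pi.single i ((s : ℂ))) p - shiftPoly (Pi.single j ((s : ℂ))) p) ∧
          ((MvPolynomial.X i + MvPolynomial.X j) ∣
            shiftPoly (Pi.single i (-(s : ℂ))) p - shiftPoly (Pi.single j ((s : ℂ))) p))}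

/-- The `B_N` quasi-invariants `Q_{m̃}` with multiplicity `m̃(e_i) = m_1 + m_2`,
`m̃(e_i ± e_j) = m_3`. -/
def QtildeBC (N : ℕ) (m1 m2 m3 : ℕ) : Set (MvPolynomial (Fin N) ℂ) :=
  {q | (∀ j : Fin N, MvPolynomial.X j ^ (2 * (m1 + m2)) ∣ q - sigmaP j q) ∧
       (∀ i j : Fin N, i ≠ j →
          ((MvPolynomial.X i - MvPolynomial.X j) ^ (2 * m3) ∣ q - swapP i j q) ∧
          ((MvPolynomial.X i + MvPolynomial.X j) ^ (2 * m3) ∣ q - rhoP i j q))}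


/-- The polynomial vector field `L = Σ f_i ∂_i` applied to a polynomial. -/
def applyVF {n : ℕ} (f : Fin n → MvPolynomial (Fin n) ℂ) (p : MvPolynomial (Fin n) ℂ) :
    MvPolynomial (Fin n) ℂ :=
  ∑ i, f i * MvPolynomial.pderiv i p

/-- Invariance of a polynomial under the hyperoctahedral group `W(B_N)`
(equivalently, under its generators `σ_j` and `τ_{ij}`). -/
def BInv {N : ℕ} (p : MvPolynomial (Fin N) ℂ) : Prop :=
  (∀ j : Fin N, sigmaP j p = p) ∧ (∀ i j : Fin N, i ≠ j → swapP i j p = p)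

/-- `W(B_N)`-invariance of a vector field: `(w·L)(p) = w·(L(w⁻¹·p)) = L(p)` for the
generators `σ_j`, `τ_{ij}` of `W(B_N)` (both of which are involutions). -/
def BInvVF {N : ℕ} (f : Fin N → MvPolynomial (Fin N) ℂ) : Prop :=
  (∀ j : Fin N, ∀ p, sigmaP j (applyVF f (sigmaP j p)) = applyVF f p) ∧
  (∀ i j : Fin N, i ≠ j → ∀ p, swapP i j (applyVF f (swapP i j p)) = applyVF f p)

/-- Membership in `D(BCCat)`: the logarithmic conditions along all hyperplanes of the
extended Catalan arrangement `BCCat` of type `BC_N`. -/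
def DBCCat (N : ℕ) (m1 m2 m3 : ℕ) : Set (Fin N → MvPolynomial (Fin N) ℂ) :=
  {f | (∀ i : Fin N, ∀ j : ℤ, -(m1 : ℤ) ≤ j → j ≤ (m1 : ℤ) →
          (MvPolynomial.X i - MvPolynomial.C (j : ℂ)) ∣ f i) ∧
       (∀ i : Fin N, ∀ j : ℕ, 1 ≤ j → j ≤ m2 →
          ((MvPolynomial.C 2 * MvPolynomial.X i - MvPolynomial.C (2 * (j : ℂ) - 1)) ∣ f i) ∧
          ((MvPolynomial.C 2 * MvPolynomial.X i + MvPolynomial.C (2 * (j : ℂ) - 1)) ∣ f i)) ∧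
       (∀ i j : Fin N, i < j → ∀ k : ℤ, -(m3 : ℤ) ≤ k → k ≤ (m3 : ℤ) →
          ((MvPolynomial.X i - MvPolynomial.X j - MvPolynomial.C (k : ℂ)) ∣ f i - f j) ∧
          ((MvPolynomial.X i + MvPolynomial.X j - MvPolynomial.C (k : ℂ)) ∣ f i + f j))}

namespace Polynomial.Catalan

section Fields

variable {A B : Type*} [CommRing A] [Algebra ℂ A] [CommRing B] [Algebra ℂ B]

/-- The product of `x + c` over the `n` consecutive translates `c` centred at `0`. -/
def centredProd (n : ℕ) (x : A) : A :=
  ∏ i ∈ Finset.range n, (x + algebraMap ℂ A (((n : ℂ) - 1) / 2 - i))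

theorem centredProd_succ_add_half (n : ℕ) (x : A) :
    centredProd (n + 1) (x + algebraMap ℂ A (1 / 2)) =
      centredProd n x * (x + algebraMap ℂ A (((n : ℂ) + 1) / 2)) := by
  unfold centredProd
  rw [Finset.prod_range_succ']
  congr 1
  · refine Finset.prod_congr rfl fun i _ => ?_
    rw [add_assoc, ← map_add]
    congr 2
    push_cast
    ring
  · rw [add_assoc, ← map_add]
    congr 2
    push_cast
    ring

theorem centredProd_neg (n : ℕ) (x : A) :
    centredProd n (-x) = (-1) ^ n * centredProd n x := by
  unfold centredProd
  rw [← Finset.prod_range_reflect, ← Finset.card_range n, ← Finset.prod_const,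
    Finset.card_range, ← Finset.prod_mul_distrib]
  refine Finset.prod_congr rfl fun i hi => ?_
  have hi' : i + 1 ≤ n := Finset.mem_range.1 hi
  have h : ((n - 1 - i : ℕ) : ℂ) = n - 1 - i := by
    rw [Nat.sub_sub, Nat.cast_sub (by omega)]
    push_cast
    ring
  rw [h, neg_one_mul, neg_add, ← map_neg]
  congr 2
  ring

theorem centredProd_add_two (n : ℕ) (x : A) :
    centredProd (n + 2) x =
      centredProd n x * (x ^ 2 - algebraMap ℂ A (((n : ℂ) + 1) / 2) ^ 2) := by
  unfold centredProd
  rw [Finset.prod_range_succ, Finset.prod_range_succ', mul_assoc]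
  congr 1
  · refine Finset.prod_congr rfl fun i _ => ?_
    congr 2
    push_cast
    ring
  · rw [sq_sub_sq, sub_eq_add_neg x, ← map_neg]
    congr 3
    · push_cast
      ring
    · push_cast
      ring

theorem map_centredProd (φ : A →ₐ[ℂ] B) (n : ℕ) (x : A) :
    φ (centredProd n x) = centredProd n (φ x) := by
  simp [centredProd, map_prod]

theorem centredProd_dvd_add_two_mul (n l : ℕ) (x : A) :
    centredProd n x ∣ centredProd (n + 2 * l) x := by
  induction l with
  | zero => simp
  | succ l ih => exact ih.trans (Dvd.intro _ (centredProd_add_two (n + 2 * l) x).symm)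

/-- The polynomial in `s` whose roots are the squares `(x + c) ^ 2`, for the `m` consecutive
translates `c` centred at `0`. -/
def sqKernel (m : ℕ) (x : A) : A[X] :=
  ∏ i ∈ Finset.range m, (X - C ((x + algebraMap ℂ A (((m : ℂ) - 1) / 2 - i)) ^ 2))

theorem sqKernel_neg (m : ℕ) (x : A) : sqKernel m (-x) = sqKernel m x := by
  unfold sqKernel
  rw [← Finset.prod_range_reflect]
  refine Finset.prod_congr rfl fun i hi => ?_
  have hi' : i + 1 ≤ m := Finset.mem_range.1 hi
  have h : ((m - 1 - i : ℕ) : ℂ) = m - 1 - i := by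
    rw [Nat.sub_sub, Nat.cast_sub (by omega)]
    push_cast
    ring
  rw [h, ← neg_sq, neg_add, ← map_neg, neg_neg]
  congr 5
  ring

theorem sqKernel_add (j k : ℕ) (x : A) :
    sqKernel (j + k) x =
      sqKernel j (x + algebraMap ℂ A (k / 2)) * sqKernel k (x - algebraMap ℂ A (j / 2)) := by
  unfold sqKernel
  rw [Finset.prod_range_add]
  congr 1
  · refine Finset.prod_congr rfl fun i _ => ?_
    rw [add_assoc, ← map_add]
    congr 5
    push_cast
    ring
  · refine Finset.prod_congr rfl fun i _ => ?_
    rw [sub_eq_add_neg x, add_assoc, ← map_neg, ← map_add]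
    congr 5
    push_cast
    ring

theorem sqKernel_one (x : A) : sqKernel 1 x = X - C (x ^ 2) := by
  simp [sqKernel]

theorem map_sqKernel (φ : A →ₐ[ℂ] B) (m : ℕ) (x : A) :
    (sqKernel m x).map (φ : A →+* B) = sqKernel m (φ x) := by
  simp [sqKernel, Polynomial.map_prod]

theorem sqKernel_monic (m : ℕ) (x : A) : (sqKernel m x).Monic :=
  monic_prod_of_monic _ _ fun _ _ => monic_X_sub_C _

theorem natDegree_sqKernel [Nontrivial A] (m : ℕ) (x : A) : (sqKernel m x).natDegree = m := by
  rw [sqKernel, natDegree_prod_of_monic _ _ fun _ _ => monic_X_sub_C _]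
  simp only [natDegree_X_sub_C, Finset.sum_const, Finset.card_range, smul_eq_mul, mul_one]

/-- Half the regularised integral of `s ^ ((o - 2) / 2) * (s - 1) ^ m` over `[0, 1]`. -/
def oddBeta (m : ℕ) (o : ℤ) : ℂ :=
  (∏ i ∈ Finset.range m, (-(2 * i + 2) : ℂ)) / ∏ i ∈ Finset.range (m + 1), ((o : ℂ) + 2 * i)

theorem odd_add_two_mul_ne_zero {o : ℤ} (ho : Odd o) (i : ℕ) : (o : ℂ) + 2 * i ≠ 0 := by
  have h : o + 2 * i ≠ 0 := by
    obtain ⟨r, rfl⟩ := ho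
    omega
  exact_mod_cast h

theorem oddBeta_ne_zero (m : ℕ) {o : ℤ} (ho : Odd o) : oddBeta m o ≠ 0 := by
  refine div_ne_zero (Finset.prod_ne_zero_iff.2 fun i _ => neg_ne_zero.2 ?_)
    (Finset.prod_ne_zero_iff.2 fun i _ => odd_add_two_mul_ne_zero ho i)
  norm_cast

theorem oddBeta_succ (m : ℕ) {o : ℤ} (ho : Odd o) :
    (o + 2 * m + 2 : ℂ) * oddBeta (m + 1) o = -(2 * m + 2) * oddBeta m o := by
  have h := odd_add_two_mul_ne_zero ho (m + 1)
  have h' : ∏ i ∈ Finset.range (m + 1), ((o : ℂ) + 2 * i) ≠ 0 :=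
    Finset.prod_ne_zero_iff.2 fun i _ => odd_add_two_mul_ne_zero ho i
  unfold oddBeta
  rw [Finset.prod_range_succ _ (m + 1), Finset.prod_range_succ _ m]
  push_cast at h ⊢
  field_simp
  ring

theorem oddBeta_add_two (m : ℕ) {o : ℤ} (ho : Odd o) :
    (o + 2 * m + 2 : ℂ) * oddBeta m (o + 2) = o * oddBeta m o := by
  have h := odd_add_two_mul_ne_zero ho (m + 1)
  have h0 := odd_add_two_mul_ne_zero ho 0
  have h' : ∏ i ∈ Finset.range m, ((o : ℂ) + 2 * (i + 1 : ℕ)) ≠ 0 :=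
    Finset.prod_ne_zero_iff.2 fun i _ => odd_add_two_mul_ne_zero ho _
  have e : ∏ i ∈ Finset.range (m + 1), (((o + 2 : ℤ) : ℂ) + 2 * i) =
      (∏ i ∈ Finset.range m, ((o : ℂ) + 2 * (i + 1 : ℕ))) * (o + 2 * (m + 1 : ℕ)) := by
    rw [← Finset.prod_range_succ (fun i : ℕ => (o : ℂ) + 2 * (i + 1 : ℕ))]
    refine Finset.prod_congr rfl fun i _ => ?_
    push_cast
    ring
  unfold oddBeta
  rw [e, Finset.prod_range_succ' _ m]
  simp only [Nat.cast_zero, mul_zero, add_zero] at h0 ⊢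
  push_cast at h h' ⊢
  field_simp
  ring

/-- The Newton polynomials with nodes `(d / 2) ^ 2, (d / 2 + 1) ^ 2, …`. -/
def sqNewton (d : ℂ) (n : ℕ) : ℂ[X] :=
  ∏ i ∈ Finset.range n, (X - C ((d / 2 + i) ^ 2))

theorem sqNewton_monic (d : ℂ) (n : ℕ) : (sqNewton d n).Monic :=
  monic_prod_of_monic _ _ fun _ _ => monic_X_sub_C _

theorem natDegree_sqNewton (d : ℂ) (n : ℕ) : (sqNewton d n).natDegree = n := by
  rw [sqNewton, natDegree_prod_of_monic _ _ fun _ _ => monic_X_sub_C _]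
  simp only [natDegree_X_sub_C, Finset.sum_const, Finset.card_range, smul_eq_mul, mul_one]

/-- The Newton polynomials form a basis of `ℂ[X]`. -/
def sqNewtonBasis (d : ℂ) : Module.Basis ℕ ℂ ℂ[X] :=
  Polynomial.Sequence.basis
    ⟨sqNewton d, fun n => by
      rw [degree_eq_natDegree (sqNewton_monic d n).ne_zero, natDegree_sqNewton]⟩
    fun n => by
      change IsUnit (sqNewton d n).leadingCoeff
      rw [sqNewton_monic]
      exact isUnit_one

theorem sqNewtonBasis_apply (d : ℂ) (n : ℕ) : sqNewtonBasis d n = sqNewton d n := by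
  rw [sqNewtonBasis, Polynomial.Sequence.basis_eq_self]

/-- The linear functional of `discreteIntegral`, on polynomials with constant coefficients and
for a generic endpoint. -/
def genericIntegral (n₁ n₂ m : ℕ) : ℂ[X] →ₗ[ℂ] ℂ[X] :=
  (sqNewtonBasis ((n₁ : ℂ) - m)).constr ℂ fun n =>
    C (oddBeta m ((n₁ : ℤ) + n₂ - 2 * m + 2 * n)) * centredProd (n₁ + 2 * n) X * centredProd n₂ X

/-- The discrete analogue of `g ↦ ∫ t in 0..x, t ^ (n₁ + n₂ - 2 * m - 1) * (t² - x²) ^ m * g (t²)`. -/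
def discreteIntegral (n₁ n₂ m : ℕ) (x : A) : A[X] →ₗ[A] A :=
  (Polynomial.basisMonomials A).constr A fun l => aeval x (genericIntegral n₁ n₂ m (X ^ l))

theorem discreteIntegral_X_pow (n₁ n₂ m : ℕ) (x : A) (l : ℕ) :
    discreteIntegral n₁ n₂ m x (X ^ l) = aeval x (genericIntegral n₁ n₂ m (X ^ l)) := by
  have h := (Polynomial.basisMonomials A).constr_basis A
    (fun l => aeval x (genericIntegral n₁ n₂ m (X ^ l))) l
  rw [← monomial_one_right_eq_X_pow]
  rwa [coe_basisMonomials] at h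

theorem discreteIntegral_map_algebraMap (n₁ n₂ m : ℕ) (x : A) (g : ℂ[X]) :
    discreteIntegral n₁ n₂ m x (g.map (algebraMap ℂ A)) = aeval x (genericIntegral n₁ n₂ m g) := by
  induction g using Polynomial.induction_on' with
  | add p q hp hq => simp only [Polynomial.map_add, map_add, hp, hq]
  | monomial n a =>
    rw [← C_mul_X_pow_eq_monomial, Polynomial.map_mul, map_C, Polynomial.map_pow, map_X,
      ← smul_eq_C_mul, ← smul_eq_C_mul, LinearMap.map_smul, LinearMap.map_smul,
      discreteIntegral_X_pow, map_smul, smul_eq_mul, Algebra.smul_def]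

theorem discreteIntegral_sqNewton (n₁ n₂ m : ℕ) (x : A) (n : ℕ) :
    discreteIntegral n₁ n₂ m x ((sqNewton ((n₁ : ℂ) - m) n).map (algebraMap ℂ A)) =
      algebraMap ℂ A (oddBeta m ((n₁ : ℤ) + n₂ - 2 * m + 2 * n)) * centredProd (n₁ + 2 * n) x *
        centredProd n₂ x := by
  rw [discreteIntegral_map_algebraMap, genericIntegral, ← sqNewtonBasis_apply,
    Module.Basis.constr_basis]
  simp [map_centredProd]

theorem linearMap_ext_sqNewton (d : ℂ) {F G : A[X] →ₗ[A] A}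
    (h : ∀ n, F ((sqNewton d n).map (algebraMap ℂ A)) = G ((sqNewton d n).map (algebraMap ℂ A))) :
    F = G := by
  have key : (F.restrictScalars ℂ) ∘ₗ (Polynomial.mapAlgHom (Algebra.ofId ℂ A)).toLinearMap =
      (G.restrictScalars ℂ) ∘ₗ (Polynomial.mapAlgHom (Algebra.ofId ℂ A)).toLinearMap := by
    refine (sqNewtonBasis d).ext fun n => ?_
    rw [sqNewtonBasis_apply]
    exact h n
  refine (Polynomial.basisMonomials A).ext fun l => ?_
  have := LinearMap.congr_fun key (X ^ l)
  simpa [monomial_one_right_eq_X_pow] using this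

theorem map_discreteIntegral (φ : A →ₐ[ℂ] B) (n₁ n₂ m : ℕ) (x : A) (g : A[X]) :
    φ (discreteIntegral n₁ n₂ m x g) =
      discreteIntegral n₁ n₂ m (φ x) (g.map (φ : A →+* B)) := by
  induction g using Polynomial.induction_on' with
  | add p q hp hq => simp only [Polynomial.map_add, map_add, hp, hq]
  | monomial n a =>
    rw [← C_mul_X_pow_eq_monomial, Polynomial.map_mul, map_C, Polynomial.map_pow, map_X,
      ← smul_eq_C_mul, ← smul_eq_C_mul, LinearMap.map_smul, LinearMap.map_smul,
      discreteIntegral_X_pow, discreteIntegral_X_pow, smul_eq_mul, smul_eq_mul, map_mul,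
      ← Polynomial.aeval_algHom_apply]
    rfl

theorem dvd_discreteIntegral (n₁ n₂ m : ℕ) (x : A) (g : A[X]) :
    centredProd n₁ x * centredProd n₂ x ∣ discreteIntegral n₁ n₂ m x g := by
  rw [← Ideal.mem_span_singleton, ← Ideal.Quotient.eq_zero_iff_mem]
  set I := Ideal.span {centredProd n₁ x * centredProd n₂ x}
  have key : discreteIntegral n₁ n₂ m (Ideal.Quotient.mkₐ ℂ I x) = 0 := by
    refine linearMap_ext_sqNewton ((n₁ : ℂ) - m) fun n => ?_
    rw [discreteIntegral_sqNewton, ← map_centredProd, ← map_centredProd, mul_assoc, ← map_mul]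
    have : Ideal.Quotient.mkₐ ℂ I (centredProd (n₁ + 2 * n) x * centredProd n₂ x) = 0 :=
      Ideal.Quotient.eq_zero_iff_mem.2 (Ideal.mem_span_singleton.2
        (mul_dvd_mul_right (centredProd_dvd_add_two_mul _ _ _) _))
    rw [this, mul_zero, LinearMap.zero_apply]
  have h := map_discreteIntegral (Ideal.Quotient.mkₐ ℂ I) n₁ n₂ m x g
  rw [key, LinearMap.zero_apply] at h
  exact h

theorem discreteIntegral_neg {n₁ n₂ : ℕ} (h : Odd (n₁ + n₂)) (m : ℕ) (x : A) (g : A[X]) :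
    discreteIntegral n₁ n₂ m (-x) g = -discreteIntegral n₁ n₂ m x g := by
  have key : discreteIntegral n₁ n₂ m (-x) = -discreteIntegral n₁ n₂ m x := by
    refine linearMap_ext_sqNewton ((n₁ : ℂ) - m) fun n => ?_
    rw [LinearMap.neg_apply, discreteIntegral_sqNewton, discreteIntegral_sqNewton, centredProd_neg,
      centredProd_neg]
    have e : (-1 : A) ^ (n₁ + 2 * n) * (-1) ^ n₂ = -1 := by
      rw [← pow_add]
      refine Odd.neg_one_pow ?_
      obtain ⟨r, hr⟩ := h
      exact ⟨r + n, by omega⟩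
    linear_combination (algebraMap ℂ A (oddBeta m ((n₁ : ℤ) + n₂ - 2 * m + 2 * n)) *
      centredProd (n₁ + 2 * n) x * centredProd n₂ x) * e
  rw [key, LinearMap.neg_apply]

theorem discreteIntegral_X_sub_C_sq_mul {n₁ n₂ : ℕ} (h : Odd (n₁ + n₂)) (m : ℕ) (x : A) (g : A[X]) :
    discreteIntegral n₁ n₂ m x ((X - C ((x + algebraMap ℂ A ((m + 1) / 2)) ^ 2)) * g) =
      discreteIntegral (n₁ + 1) (n₂ + 1) (m + 1) (x + algebraMap ℂ A (1 / 2)) g := by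
  have key : discreteIntegral n₁ n₂ m x ∘ₗ
      LinearMap.mulLeft A (X - C ((x + algebraMap ℂ A ((m + 1) / 2)) ^ 2)) =
      discreteIntegral (n₁ + 1) (n₂ + 1) (m + 1) (x + algebraMap ℂ A (1 / 2)) := by
    refine linearMap_ext_sqNewton ((n₁ : ℂ) - m) fun n => ?_
    have hd : (n₁ : ℂ) - m = ((n₁ + 1 : ℕ) : ℂ) - (m + 1 : ℕ) := by
      push_cast
      ring
    have hs : (X - C ((x + algebraMap ℂ A ((m + 1) / 2)) ^ 2)) *
        (sqNewton ((n₁ : ℂ) - m) n).map (algebraMap ℂ A) =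
        (sqNewton ((n₁ : ℂ) - m) (n + 1)).map (algebraMap ℂ A) +
          ((algebraMap ℂ A (((n₁ : ℂ) - m) / 2 + n)) ^ 2 -
            (x + algebraMap ℂ A ((m + 1) / 2)) ^ 2) •
            (sqNewton ((n₁ : ℂ) - m) n).map (algebraMap ℂ A) := by
      rw [sqNewton, sqNewton, Finset.prod_range_succ, Polynomial.map_mul, smul_eq_C_mul]
      rw [Polynomial.map_sub, map_X, Polynomial.map_C, C_sub, map_pow (algebraMap ℂ A)]
      ring
    rw [LinearMap.comp_apply, LinearMap.mulLeft_apply, hs, map_add, map_smul,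
      discreteIntegral_sqNewton, discreteIntegral_sqNewton]
    conv_rhs => rw [hd, discreteIntegral_sqNewton]
    have e : n₁ + 2 * (n + 1) = n₁ + 2 * n + 2 := by ring
    have e' : n₁ + 1 + 2 * n = n₁ + 2 * n + 1 := by ring
    rw [e, e', centredProd_add_two, centredProd_succ_add_half, centredProd_succ_add_half]
    set o : ℤ := (n₁ : ℤ) + n₂ - 2 * m + 2 * n with ho
    have ho' : Odd o := by
      obtain ⟨r, hr⟩ := h
      exact ⟨r - m + n, by omega⟩
    have e₁ : (n₁ : ℤ) + n₂ - 2 * m + 2 * (n + 1 : ℕ) = o + 2 := by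
      rw [ho]
      push_cast
      ring
    have e₂ : ((n₁ + 1 : ℕ) : ℤ) + (n₂ + 1 : ℕ) - 2 * (m + 1 : ℕ) + 2 * n = o := by
      rw [ho]
      push_cast
      ring
    rw [e₁, e₂]
    have hne : (o : ℂ) + 2 * m + 2 ≠ 0 := by
      have := odd_add_two_mul_ne_zero ho' (m + 1)
      push_cast at this
      intro h0
      exact this (by linear_combination h0)
    have hb₁ : oddBeta m (o + 2) = o / (o + 2 * m + 2) * oddBeta m o := by
      rw [div_mul_eq_mul_div, eq_div_iff hne, ← oddBeta_add_two m ho', mul_comm]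
    have hb₂ : oddBeta (m + 1) o = -(2 * m + 2) / (o + 2 * m + 2) * oddBeta m o := by
      rw [div_mul_eq_mul_div, eq_div_iff hne, ← oddBeta_succ m ho', mul_comm]
    obtain ⟨v, hv⟩ : ∃ v : ℂ, v = ((n₁ : ℂ) - m) / 2 + n := ⟨_, rfl⟩
    obtain ⟨u, hu⟩ : ∃ u : ℂ, u = ((n₂ : ℂ) + 1) / 2 := ⟨_, rfl⟩
    obtain ⟨μ, hμ⟩ : ∃ μ : ℂ, μ = ((m : ℂ) + 1) / 2 := ⟨_, rfl⟩
    have ho'' : (o : ℂ) = 2 * v + 2 * u - 2 * μ := by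
      rw [ho, hv, hu, hμ]
      push_cast
      ring
    have hw : (o : ℂ) + 2 * m + 2 = 2 * v + 2 * μ + 2 * u := by
      rw [ho'', hμ]
      ring
    have hvμ : (((n₁ + 2 * n : ℕ) : ℂ) + 1) / 2 = v + μ := by
      rw [hv, hμ]
      push_cast
      ring
    have hm : -(2 * (m : ℂ) + 2) = -(4 * μ) := by
      rw [hμ]
      ring
    have hw' : (2 * v + 2 * μ + 2 * u) * (2 * v + 2 * μ + 2 * u)⁻¹ = 1 :=
      mul_inv_cancel₀ (hw ▸ hne)
    rw [hb₁, hb₂, hvμ, hm, hw, ho'', ← hv, ← hu, ← hμ, div_eq_mul_inv, div_eq_mul_inv]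
    generalize (2 * v + 2 * μ + 2 * u)⁻¹ = w at hw' ⊢
    replace hw' := congrArg (algebraMap ℂ A) hw'
    simp only [map_mul, map_add, map_sub, map_neg, map_one, map_ofNat, smul_eq_mul] at hw' ⊢
    generalize algebraMap ℂ A v = v at *
    generalize algebraMap ℂ A u = u at *
    generalize algebraMap ℂ A μ = μ at *
    generalize algebraMap ℂ A w = w at *
    linear_combination (-(v ^ 2 - (x + μ) ^ 2) * (algebraMap ℂ A (oddBeta m o) *
      centredProd (n₁ + 2 * n) x * centredProd n₂ x)) * hw'
  exact LinearMap.congr_fun key g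

theorem discreteIntegral_sqKernel_mul {n₁ n₂ : ℕ} (h : Odd (n₁ + n₂)) (m k : ℕ) (x : A)
    (g : A[X]) :
    discreteIntegral n₁ n₂ m x (sqKernel k (x + algebraMap ℂ A ((m + k) / 2)) * g) =
      discreteIntegral (n₁ + k) (n₂ + k) (m + k) (x + algebraMap ℂ A (k / 2)) g := by
  induction k generalizing g with
  | zero => simp [sqKernel]
  | succ k ih =>
    have e₁ : x + algebraMap ℂ A ((m + (k + 1 : ℕ)) / 2) + algebraMap ℂ A ((1 : ℕ) / 2) -
        algebraMap ℂ A (1 / 2) = x + algebraMap ℂ A ((m + (k + 1 : ℕ)) / 2) := by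
      push_cast
      ring
    have e₂ : x + algebraMap ℂ A ((m + (k + 1 : ℕ)) / 2) - algebraMap ℂ A ((1 : ℕ) / 2) =
        x + algebraMap ℂ A ((m + k) / 2) := by
      rw [sub_eq_add_neg, add_assoc, ← map_neg, ← map_add]
      congr 2
      push_cast
      ring
    have e₃ : x + algebraMap ℂ A ((m + (k + 1 : ℕ)) / 2) + algebraMap ℂ A (k / 2) =
        x + algebraMap ℂ A (k / 2) + algebraMap ℂ A (((m + k : ℕ) + 1) / 2) := by
      rw [add_assoc, add_assoc, ← map_add, ← map_add]
      congr 2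
      push_cast
      ring
    have e₄ : x + algebraMap ℂ A (k / 2) + algebraMap ℂ A (1 / 2) =
        x + algebraMap ℂ A ((k + 1 : ℕ) / 2) := by
      rw [add_assoc, ← map_add]
      congr 2
      push_cast
      ring
    have hodd : Odd (n₁ + k + (n₂ + k)) := by
      obtain ⟨r, hr⟩ := h
      exact ⟨r + k, by omega⟩
    rw [add_comm k 1, sqKernel_add, add_comm 1 k, e₂, e₃, mul_comm (sqKernel 1 _), mul_assoc, ih,
      sqKernel_one, discreteIntegral_X_sub_C_sq_mul hodd, e₄]
    rfl

/-- The reciprocity behind the logarithmic conditions along `x - y = k`. -/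
theorem discreteIntegral_add_sqKernel_mul {n₁ n₂ : ℕ} (h : Odd (n₁ + n₂)) {m k : ℕ} (hk : k ≤ m)
    (y : A) (g : A[X]) :
    discreteIntegral n₁ n₂ m (y + algebraMap ℂ A k) (sqKernel m y * g) =
      discreteIntegral n₁ n₂ m y (sqKernel m (y + algebraMap ℂ A k) * g) := by
  obtain ⟨l, rfl⟩ := Nat.exists_eq_add_of_le hk
  have hodd : Odd (n₁ + k + (n₂ + k)) := by
    obtain ⟨r, hr⟩ := h
    exact ⟨r + k, by omega⟩
  have e₁ : y - algebraMap ℂ A (l / 2) =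
      -(-(y + algebraMap ℂ A k) + algebraMap ℂ A (((k + l : ℕ) + k) / 2)) := by
    have : (((k + l : ℕ) : ℂ) + k) / 2 = l / 2 + k := by
      push_cast
      ring
    rw [this, map_add]
    ring
  have e₂ : -(y + algebraMap ℂ A k) + algebraMap ℂ A (k / 2) = -(y + algebraMap ℂ A (k / 2)) := by
    have : algebraMap ℂ A k = algebraMap ℂ A (k / 2) + algebraMap ℂ A (k / 2) := by
      rw [← map_add, add_halves]
    rw [this]
    ring
  have e₃ : y + algebraMap ℂ A k + algebraMap ℂ A (l / 2) =
      y + algebraMap ℂ A (((k + l : ℕ) + k) / 2) := by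
    rw [add_assoc, ← map_add]
    congr 2
    push_cast
    ring
  have e₄ : y + algebraMap ℂ A k - algebraMap ℂ A (k / 2) = y + algebraMap ℂ A (k / 2) := by
    have : algebraMap ℂ A k = algebraMap ℂ A (k / 2) + algebraMap ℂ A (k / 2) := by
      rw [← map_add, add_halves]
    rw [this]
    ring
  have lhs : sqKernel (k + l) y = sqKernel k (y - algebraMap ℂ A (l / 2)) *
      sqKernel l (y + algebraMap ℂ A (k / 2)) := by
    rw [add_comm, sqKernel_add, mul_comm]
  have rhs : sqKernel (k + l) (y + algebraMap ℂ A k) =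
      sqKernel k (y + algebraMap ℂ A k + algebraMap ℂ A (l / 2)) *
      sqKernel l (y + algebraMap ℂ A (k / 2)) := by
    rw [sqKernel_add, e₄]
  rw [lhs, rhs, mul_assoc, mul_assoc, e₃, discreteIntegral_sqKernel_mul h, e₁, sqKernel_neg,
    ← neg_neg (discreteIntegral n₁ n₂ (k + l) (y + algebraMap ℂ A k) _),
    ← discreteIntegral_neg h, discreteIntegral_sqKernel_mul h, e₂, discreteIntegral_neg hodd,
    neg_neg]

/-- The `i`-th component of the `k`-th basic vector field, evaluated at the point `x`. -/
def catalanField (n₁ n₂ m : ℕ) {N : ℕ} (x : Fin N → A) (k : ℕ) (i : Fin N) : A :=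
  discreteIntegral n₁ n₂ m (x i)
    ((∏ j ∈ Finset.univ.erase i, sqKernel m (x j)) * X ^ k)

theorem map_catalanField (φ : A →ₐ[ℂ] B) (n₁ n₂ m : ℕ) {N : ℕ} (x : Fin N → A) (k : ℕ)
    (i : Fin N) :
    φ (catalanField n₁ n₂ m x k i) = catalanField n₁ n₂ m (fun j => φ (x j)) k i := by
  rw [catalanField, map_discreteIntegral, Polynomial.map_mul, Polynomial.map_prod,
    Polynomial.map_pow, map_X]
  simp only [map_sqKernel]
  rfl

theorem catalanField_comp_perm (n₁ n₂ m : ℕ) {N : ℕ} (x : Fin N → A) (e : Equiv.Perm (Fin N))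
    (k : ℕ) (i : Fin N) :
    catalanField n₁ n₂ m (fun j => x (e j)) k i = catalanField n₁ n₂ m x k (e i) := by
  unfold catalanField
  congr 2
  refine Finset.prod_equiv e ?_ fun _ _ => rfl
  simp

theorem prod_sqKernel_of_eq_or_neg (m : ℕ) {N : ℕ} {x y : Fin N → A}
    (h : ∀ j, y j = x j ∨ y j = -x j) (s : Finset (Fin N)) :
    ∏ j ∈ s, sqKernel m (y j) = ∏ j ∈ s, sqKernel m (x j) := by
  refine Finset.prod_congr rfl fun j _ => ?_
  rcases h j with h | h
  · rw [h]
  · rw [h, sqKernel_neg]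

theorem catalanField_of_eq (n₁ n₂ m : ℕ) {N : ℕ} {x y : Fin N → A}
    (h : ∀ j, y j = x j ∨ y j = -x j) {i : Fin N} (hi : y i = x i) (k : ℕ) :
    catalanField n₁ n₂ m y k i = catalanField n₁ n₂ m x k i := by
  rw [catalanField, prod_sqKernel_of_eq_or_neg m h, hi]
  rfl

theorem catalanField_of_eq_neg {n₁ n₂ : ℕ} (hn : Odd (n₁ + n₂)) (m : ℕ) {N : ℕ} {x y : Fin N → A}
    (h : ∀ j, y j = x j ∨ y j = -x j) {i : Fin N} (hi : y i = -x i) (k : ℕ) :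
    catalanField n₁ n₂ m y k i = -catalanField n₁ n₂ m x k i := by
  rw [catalanField, prod_sqKernel_of_eq_or_neg m h, hi, discreteIntegral_neg hn]
  rfl

theorem catalanField_eq_of_eq_add_natCast {n₁ n₂ : ℕ} (hn : Odd (n₁ + n₂)) {m N : ℕ}
    {x : Fin N → A} {i j : Fin N} (hij : i ≠ j) {l : ℕ} (hl : l ≤ m)
    (h : x i = x j + algebraMap ℂ A l) (k : ℕ) :
    catalanField n₁ n₂ m x k i = catalanField n₁ n₂ m x k j := by
  unfold catalanField
  rw [← Finset.mul_prod_erase (Finset.univ.erase i) _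
      (Finset.mem_erase.2 ⟨hij.symm, Finset.mem_univ j⟩),
    ← Finset.mul_prod_erase (Finset.univ.erase j) _
      (Finset.mem_erase.2 ⟨hij, Finset.mem_univ i⟩), Finset.erase_right_comm, mul_assoc, mul_assoc,
    h, discreteIntegral_add_sqKernel_mul hn hl]

theorem catalanField_eq_of_eq_add_intCast {n₁ n₂ : ℕ} (hn : Odd (n₁ + n₂)) {m N : ℕ}
    {x : Fin N → A} {i j : Fin N} (hij : i ≠ j) {l : ℤ} (hl : -(m : ℤ) ≤ l) (hl' : l ≤ m)
    (h : x i = x j + algebraMap ℂ A l) (k : ℕ) :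
    catalanField n₁ n₂ m x k i = catalanField n₁ n₂ m x k j := by
  obtain ⟨r, rfl | rfl⟩ := l.eq_nat_or_neg
  · exact catalanField_eq_of_eq_add_natCast hn hij (l := r) (by omega) (by simpa using h) k
  · refine (catalanField_eq_of_eq_add_natCast hn hij.symm (l := r) (by omega) ?_ k).symm
    rw [h]
    simp

theorem catalanField_eq_neg_of_eq_neg_add_intCast {n₁ n₂ : ℕ} (hn : Odd (n₁ + n₂)) {m N : ℕ}
    {x : Fin N → A} {i j : Fin N} (hij : i ≠ j) {l : ℤ} (hl : -(m : ℤ) ≤ l) (hl' : l ≤ m)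
    (h : x i = -x j + algebraMap ℂ A l) (k : ℕ) :
    catalanField n₁ n₂ m x k i = -catalanField n₁ n₂ m x k j := by
  have hy : ∀ r, Function.update x j (-x j) r = x r ∨ Function.update x j (-x j) r = -x r := by
    intro r
    by_cases hr : r = j
    · subst hr
      simp
    · simp [hr]
  have hi : Function.update x j (-x j) i = x i := Function.update_of_ne hij _ _
  have hj : Function.update x j (-x j) j = -x j := Function.update_self _ _ _
  rw [← catalanField_of_eq n₁ n₂ m hy hi, ← catalanField_of_eq_neg hn m hy hj]
  refine catalanField_eq_of_eq_add_intCast hn hij hl hl' ?_ k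
  rw [hi, hj, h]

theorem centredProd_add_C_monic (n : ℕ) (a : A) : (centredProd n (X + C a : A[X])).Monic :=
  monic_prod_of_monic _ _ fun i _ => by
    rw [add_assoc, IsScalarTower.algebraMap_apply ℂ A A[X], algebraMap_eq, ← C_add]
    exact monic_X_add_C _

theorem natDegree_centredProd_add_C [Nontrivial A] (n : ℕ) (a : A) :
    (centredProd n (X + C a : A[X])).natDegree = n := by
  have h : ∀ i : ℕ, X + C a + algebraMap ℂ A[X] (((n : ℂ) - 1) / 2 - i) =
      X + C (a + algebraMap ℂ A (((n : ℂ) - 1) / 2 - i)) := fun i => by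
    rw [add_assoc, IsScalarTower.algebraMap_apply ℂ A A[X], algebraMap_eq, ← C_add]
  unfold centredProd
  simp only [h]
  rw [natDegree_prod_of_monic _ _ fun _ _ => monic_X_add_C _]
  simp only [natDegree_X_add_C, Finset.sum_const, Finset.card_range, smul_eq_mul, mul_one]

theorem discreteIntegral_X_map_C [Nontrivial A] (n₁ n₂ m : ℕ) {D : ℕ} {H : A[X]}
    (hH : H.natDegree ≤ D) :
    (discreteIntegral n₁ n₂ m (X : A[X]) (H.map C)).natDegree ≤ n₁ + n₂ + 2 * D ∧
      (discreteIntegral n₁ n₂ m (X : A[X]) (H.map C)).coeff (n₁ + n₂ + 2 * D) =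
        algebraMap ℂ A (oddBeta m ((n₁ : ℤ) + n₂ - 2 * m + 2 * D)) * H.coeff D := by
  induction D using Nat.strong_induction_on generalizing H with
  | h D ih =>
    set P : A[X] := (sqNewton ((n₁ : ℂ) - m) D).map (algebraMap ℂ A) with hP
    have hPm : P.Monic := (sqNewton_monic _ _).map _
    have hPd : P.natDegree = D := by
      rw [hP, (sqNewton_monic _ _).natDegree_map, natDegree_sqNewton]
    have hPc : P.coeff D = 1 := by
      rw [← hPd]
      exact hPm
    set S : A[X] := centredProd (n₁ + 2 * D) X * centredProd n₂ X with hS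
    have hSm : S.Monic := by
      have h₁ := centredProd_add_C_monic (n₁ + 2 * D) (0 : A)
      have h₂ := centredProd_add_C_monic n₂ (0 : A)
      rw [C_0, add_zero] at h₁ h₂
      exact h₁.mul h₂
    have hSd : S.natDegree = n₁ + n₂ + 2 * D := by
      have h₁ := centredProd_add_C_monic (n₁ + 2 * D) (0 : A)
      have h₂ := centredProd_add_C_monic n₂ (0 : A)
      have d₁ := natDegree_centredProd_add_C (n₁ + 2 * D) (0 : A)
      have d₂ := natDegree_centredProd_add_C n₂ (0 : A)
      rw [C_0, add_zero] at h₁ h₂ d₁ d₂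
      rw [hS, h₁.natDegree_mul h₂, d₁, d₂]
      ring
    have hI : discreteIntegral n₁ n₂ m (X : A[X]) ((C (H.coeff D) * P).map C) =
        C (algebraMap ℂ A (oddBeta m ((n₁ : ℤ) + n₂ - 2 * m + 2 * D)) * H.coeff D) * S := by
      have hPC : P.map C = (sqNewton ((n₁ : ℂ) - m) D).map (algebraMap ℂ A[X]) := by
        rw [hP, Polynomial.map_map]
        rfl
      rw [Polynomial.map_mul, Polynomial.map_C, hPC, ← smul_eq_C_mul, LinearMap.map_smul,
        discreteIntegral_sqNewton, smul_eq_mul, IsScalarTower.algebraMap_apply ℂ A A[X],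
        algebraMap_eq, C_mul, hS]
      ring
    have hd : (C (algebraMap ℂ A (oddBeta m ((n₁ : ℤ) + n₂ - 2 * m + 2 * D)) * H.coeff D) *
        S).natDegree ≤ n₁ + n₂ + 2 * D := hSd ▸ natDegree_C_mul_le _ _
    have hc : (C (algebraMap ℂ A (oddBeta m ((n₁ : ℤ) + n₂ - 2 * m + 2 * D)) * H.coeff D) *
        S).coeff (n₁ + n₂ + 2 * D) =
        algebraMap ℂ A (oddBeta m ((n₁ : ℤ) + n₂ - 2 * m + 2 * D)) * H.coeff D := by
      rw [coeff_C_mul, ← hSd, coeff_natDegree, hSm, mul_one]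
    obtain ⟨R, hR⟩ : ∃ R, R = H - C (H.coeff D) * P := ⟨_, rfl⟩
    have hRd : R.natDegree ≤ D :=
      hR ▸ (natDegree_sub_le_of_le hH ((natDegree_C_mul_le _ _).trans hPd.le)).trans (max_self D).le
    have hRc : R.coeff D = 0 := by
      rw [hR, coeff_sub, coeff_C_mul, hPc, mul_one, sub_self]
    have hH' : H = R + C (H.coeff D) * P := by
      rw [hR]
      ring
    have hsplit : discreteIntegral n₁ n₂ m (X : A[X]) (H.map C) =
        discreteIntegral n₁ n₂ m (X : A[X]) (R.map C) +
          C (algebraMap ℂ A (oddBeta m ((n₁ : ℤ) + n₂ - 2 * m + 2 * D)) * H.coeff D) * S := by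
      rw [← hI, ← map_add, ← Polynomial.map_add, ← hH']
    rw [hsplit, coeff_add, hc]
    rcases Nat.eq_zero_or_pos D with h0 | hpos
    · subst h0
      have hR0 : R = 0 := by
        rw [eq_C_of_natDegree_le_zero hRd, hRc, C_0]
      rw [hR0]
      simpa using hd
    · have hRd' : R.natDegree ≤ D - 1 := by
        rw [natDegree_le_iff_coeff_eq_zero] at hRd ⊢
        intro r hr
        rcases eq_or_ne r D with rfl | hne
        · exact hRc
        · exact hRd r (by omega)
      have hlt := (ih (D - 1) (by omega) hRd').1
      refine ⟨natDegree_add_le_of_degree_le (hlt.trans (by omega)) hd, ?_⟩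
      rw [coeff_eq_zero_of_natDegree_lt (lt_of_le_of_lt hlt (by omega)), zero_add]

theorem discreteIntegral_C_map_C (n₁ n₂ m : ℕ) (y : A) (G : A[X]) :
    discreteIntegral n₁ n₂ m (C y : A[X]) (G.map C) = C (discreteIntegral n₁ n₂ m y G) :=
  (map_discreteIntegral (CAlgHom : A →ₐ[ℂ] A[X]) n₁ n₂ m y G).symm

theorem discreteIntegral_C_prod_mul [Nontrivial A] (n₁ n₂ m : ℕ) (y : A) (c : ℕ → A) (j : ℕ) (G : A[X]) :
    (discreteIntegral n₁ n₂ m (C y : A[X])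
        ((∏ i ∈ Finset.range j, (X - C ((X + C (c i)) ^ 2))) * G.map C)).natDegree ≤ 2 * j ∧
      (discreteIntegral n₁ n₂ m (C y : A[X])
        ((∏ i ∈ Finset.range j, (X - C ((X + C (c i)) ^ 2))) * G.map C)).coeff (2 * j) =
        (-1) ^ j * discreteIntegral n₁ n₂ m y G := by
  induction j generalizing G with
  | zero => simp [discreteIntegral_C_map_C]
  | succ j ih =>
    have e : (∏ i ∈ Finset.range (j + 1), (X - C ((X + C (c i)) ^ 2))) * G.map C =
        (∏ i ∈ Finset.range j, (X - C ((X + C (c i)) ^ 2))) * (X * G).map C -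
        (X + C (c j)) ^ 2 •
          ((∏ i ∈ Finset.range j, (X - C ((X + C (c i)) ^ 2))) * G.map C) := by
      rw [Finset.prod_range_succ, Polynomial.map_mul, map_X, smul_eq_C_mul]
      ring
    rw [e, map_sub, LinearMap.map_smul, smul_eq_mul]
    have h₁ := (ih (X * G)).1
    have h₂ := ih G
    have hq : ((X + C (c j)) ^ 2 : A[X]).natDegree ≤ 2 :=
      natDegree_pow_le.trans (by rw [natDegree_X_add_C])
    have hqc : ((X + C (c j)) ^ 2 : A[X]).coeff 2 = 1 := by
      have h := coeff_pow_of_natDegree_le (natDegree_X_add_C (c j)).le (m := 2)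
      simpa using h
    refine ⟨(natDegree_sub_le_of_le h₁ (natDegree_mul_le_of_le hq h₂.1)).trans
      (max_le (by omega) (by omega)), ?_⟩
    rw [coeff_sub, coeff_eq_zero_of_natDegree_lt (lt_of_le_of_lt h₁ (by omega)),
      show 2 * (j + 1) = 2 + 2 * j by ring, coeff_mul_add_eq_of_natDegree_le hq h₂.1, hqc, h₂.2]
    ring

theorem univ_erase_zero_eq_map (n : ℕ) :
    (Finset.univ.erase (0 : Fin (n + 1))) = Finset.univ.map (Fin.succEmb n) := by
  ext j
  refine Fin.cases ?_ (fun j => ?_) j <;> simp [Fin.succ_ne_zero, eq_comm]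

theorem prod_univ_erase_succ {M : Type*} [CommMonoid M] {n : ℕ} (f : Fin (n + 1) → M) (i : Fin n) :
    ∏ j ∈ Finset.univ.erase i.succ, f j = f 0 * ∏ j ∈ Finset.univ.erase i, f j.succ := by
  rw [← Finset.mul_prod_erase _ f (Finset.mem_erase.2 ⟨(Fin.succ_ne_zero i).symm, Finset.mem_univ 0⟩),
    Finset.erase_right_comm, univ_erase_zero_eq_map]
  congr 1
  refine Eq.trans ?_ (Finset.prod_map (Finset.univ.erase i) (Fin.succEmb n) f)
  refine Finset.prod_congr ?_ fun _ _ => rfl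
  ext j
  simp only [Finset.mem_erase, Finset.mem_map, Finset.mem_univ, true_and, Fin.coe_succEmb, ne_eq,
    and_true]
  constructor
  · rintro ⟨h, r, rfl⟩
    exact ⟨r, fun h' => h (h' ▸ rfl), rfl⟩
  · rintro ⟨r, h, rfl⟩
    exact ⟨fun h' => h (Fin.succ_injective _ h'), r, rfl⟩

theorem catalanField_cons_zero [Nontrivial A] (n₁ n₂ m : ℕ) {n : ℕ} (y : Fin n → A) (k : ℕ) :
    (catalanField n₁ n₂ m (Fin.cons X fun j => C (y j) : Fin (n + 1) → A[X]) k 0).natDegree ≤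
        n₁ + n₂ + 2 * (m * n + k) ∧
      (catalanField n₁ n₂ m (Fin.cons X fun j => C (y j) : Fin (n + 1) → A[X]) k 0).coeff
        (n₁ + n₂ + 2 * (m * n + k)) =
        algebraMap ℂ A (oddBeta m ((n₁ : ℤ) + n₂ - 2 * m + 2 * (m * n + k : ℕ))) := by
  have hm : (∏ j, sqKernel m (y j)).Monic := monic_prod_of_monic _ _ fun _ _ => sqKernel_monic _ _
  have hd : ((∏ j, sqKernel m (y j)) * X ^ k).natDegree = m * n + k := by
    rw [hm.natDegree_mul (monic_X_pow k), natDegree_X_pow,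
      natDegree_prod_of_monic _ _ fun _ _ => sqKernel_monic _ _]
    simp only [natDegree_sqKernel, Finset.sum_const, Finset.card_univ, Fintype.card_fin,
      smul_eq_mul, mul_comm]
  have hf : catalanField n₁ n₂ m (Fin.cons X fun j => C (y j) : Fin (n + 1) → A[X]) k 0 =
      discreteIntegral n₁ n₂ m X (((∏ j, sqKernel m (y j)) * X ^ k).map C) := by
    rw [catalanField, univ_erase_zero_eq_map, Finset.prod_map, Polynomial.map_mul,
      Polynomial.map_prod, Polynomial.map_pow, map_X]
    congr 2
    exact Finset.prod_congr rfl fun j _ =>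
      (map_sqKernel (CAlgHom : A →ₐ[ℂ] A[X]) m (y j)).symm
  have h := discreteIntegral_X_map_C n₁ n₂ m hd.le
  rw [hf]
  refine ⟨h.1, h.2.trans ?_⟩
  conv_lhs => enter [2, 2]; rw [← hd]
  rw [coeff_natDegree, (hm.mul (monic_X_pow k)).leadingCoeff, mul_one]

theorem catalanField_cons_succ [Nontrivial A] (n₁ n₂ m : ℕ) {n : ℕ} (y : Fin n → A) (k : ℕ) (i : Fin n) :
    (catalanField n₁ n₂ m (Fin.cons X fun j => C (y j) : Fin (n + 1) → A[X]) k i.succ).natDegree ≤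
        2 * m ∧
      (catalanField n₁ n₂ m (Fin.cons X fun j => C (y j) : Fin (n + 1) → A[X]) k i.succ).coeff
        (2 * m) = (-1) ^ m * catalanField n₁ n₂ m y k i := by
  have hf : catalanField n₁ n₂ m (Fin.cons X fun j => C (y j) : Fin (n + 1) → A[X]) k i.succ =
      discreteIntegral n₁ n₂ m (C (y i)) ((∏ r ∈ Finset.range m,
        (X - C ((X + C (algebraMap ℂ A (((m : ℂ) - 1) / 2 - r))) ^ 2))) *
        ((∏ j ∈ Finset.univ.erase i, sqKernel m (y j)) * X ^ k).map C) := by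
    have h₀ : sqKernel m (X : A[X]) = ∏ r ∈ Finset.range m,
        (X - C ((X + C (algebraMap ℂ A (((m : ℂ) - 1) / 2 - r))) ^ 2)) :=
      Finset.prod_congr rfl fun r _ => by rw [IsScalarTower.algebraMap_apply ℂ A A[X], algebraMap_eq]
    have h₁ : ∀ j, (sqKernel m (y j)).map C = sqKernel m (C (y j)) := fun j =>
      map_sqKernel (CAlgHom : A →ₐ[ℂ] A[X]) m (y j)
    rw [catalanField, prod_univ_erase_succ, Polynomial.map_mul, Polynomial.map_prod,
      Polynomial.map_pow, map_X, ← h₀, mul_assoc]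
    simp only [Fin.cons_zero, Fin.cons_succ, h₁]
  rw [hf]
  exact discreteIntegral_C_prod_mul n₁ n₂ m (y i) _ m _

theorem natDegree_det_le_and_coeff {R : Type*} [CommRing R] {n d : ℕ}
    {M : Matrix (Fin n) (Fin n) R[X]}
    (hM : ∀ i j, (M i j).natDegree ≤ d) :
    M.det.natDegree ≤ n * d ∧
      M.det.coeff (n * d) = (Matrix.of fun i j => (M i j).coeff d).det := by
  rw [Matrix.det_apply', Matrix.det_apply']
  have hp : ∀ σ : Equiv.Perm (Fin n), (∏ i, M (σ i) i).natDegree ≤ n * d := fun σ =>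
    (natDegree_prod_le _ _).trans <| (Finset.sum_le_sum fun i _ => hM (σ i) i).trans (by simp)
  constructor
  · refine natDegree_sum_le_of_forall_le _ _ fun σ _ => ?_
    rw [← C_eq_intCast]
    exact (natDegree_C_mul_le _ _).trans (hp σ)
  · rw [finsetSum_coeff]
    refine Finset.sum_congr rfl fun σ _ => ?_
    rw [← C_eq_intCast, coeff_C_mul]
    have h := coeff_prod_of_natDegree_le (s := Finset.univ) (fun i => M (σ i) i) d
      fun i _ => hM (σ i) i
    rw [Finset.card_univ, Fintype.card_fin] at h
    rw [h]
    rfl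

theorem det_catalanField_cons [Nontrivial A] (n₁ n₂ m : ℕ) {n : ℕ} (y : Fin n → A) :
    (Matrix.of fun (k : Fin (n + 1)) i => catalanField n₁ n₂ m
        (Fin.cons X fun j => C (y j) : Fin (n + 1) → A[X]) (k : ℕ) i).det.natDegree ≤
        n₁ + n₂ + 2 * (m * n + n) + n * (2 * m) ∧
      (Matrix.of fun (k : Fin (n + 1)) i => catalanField n₁ n₂ m
        (Fin.cons X fun j => C (y j) : Fin (n + 1) → A[X]) (k : ℕ) i).det.coeff
        (n₁ + n₂ + 2 * (m * n + n) + n * (2 * m)) =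
        algebraMap ℂ A ((-1) ^ n * oddBeta m ((n₁ : ℤ) + n₂ - 2 * m + 2 * (m * n + n : ℕ)) *
          ((-1) ^ m) ^ n) *
          (Matrix.of fun (k : Fin n) i => catalanField n₁ n₂ m y (k : ℕ) i).det := by
  set M : Matrix (Fin (n + 1)) (Fin (n + 1)) A[X] := Matrix.of fun (k : Fin (n + 1)) i => catalanField n₁ n₂ m
        (Fin.cons X fun j => C (y j) : Fin (n + 1) → A[X]) (k : ℕ) i with hM
  have hminor : ∀ k : Fin (n + 1), (M.submatrix k.succAbove Fin.succ).det.natDegree ≤ n * (2 * m) :=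
    fun k => (natDegree_det_le_and_coeff fun i j => (catalanField_cons_succ n₁ n₂ m y _ _).1).1
  have hterm : ∀ k : Fin (n + 1), ((-1) ^ (k : ℕ) * M k 0 *
      (M.submatrix k.succAbove Fin.succ).det).natDegree ≤
      n₁ + n₂ + 2 * (m * n + k) + n * (2 * m) := by
    intro k
    refine natDegree_mul_le_of_le ?_ (hminor k)
    have hs : ((-1) ^ (k : ℕ) : A[X]) = C ((-1) ^ (k : ℕ)) := by simp
    rw [hs]
    exact (natDegree_C_mul_le _ _).trans (catalanField_cons_zero n₁ n₂ m y k).1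
  rw [Matrix.det_succ_column_zero]
  constructor
  · refine natDegree_sum_le_of_forall_le _ _ fun k _ => (hterm k).trans ?_
    have := k.is_le
    omega
  · rw [finsetSum_coeff, Finset.sum_eq_single (Fin.last n)]
    · have h₀ : (M (Fin.last n) 0).natDegree ≤ _ ∧ (M (Fin.last n) 0).coeff _ = _ :=
        catalanField_cons_zero n₁ n₂ m y n
      have h₁ := natDegree_det_le_and_coeff (M := M.submatrix (Fin.last n).succAbove Fin.succ)
        (d := 2 * m) fun i j => (catalanField_cons_succ n₁ n₂ m y _ _).1
      have h₂ : (Matrix.of fun i j => ((M.submatrix (Fin.last n).succAbove Fin.succ) i j).coeff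
          (2 * m)) = ((-1 : A) ^ m) •
            (Matrix.of fun (k : Fin n) i => catalanField n₁ n₂ m y (k : ℕ) i) := by
        ext i j
        simp only [Matrix.of_apply, Matrix.submatrix_apply, Matrix.smul_apply, smul_eq_mul, hM,
          Fin.succAbove_last, Fin.val_castSucc]
        exact (catalanField_cons_succ n₁ n₂ m y _ _).2
      have hs : ((-1) ^ n : A[X]) = C ((-1) ^ n) := by simp
      rw [h₂, Matrix.det_smul, Fintype.card_fin] at h₁
      rw [Fin.val_last, mul_assoc, hs, coeff_C_mul,
        coeff_mul_add_eq_of_natDegree_le h₀.1 h₁.1, h₁.2, h₀.2]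
      simp only [map_mul, map_pow, map_neg, map_one]
      ring
    · intro k _ hk
      refine coeff_eq_zero_of_natDegree_lt (lt_of_le_of_lt (hterm k) ?_)
      have : (k : ℕ) ≠ n := fun h => hk (Fin.ext h)
      have := k.is_le
      omega
    · simp

end Fields

theorem C_dvd_of_dvd_monic_mul {R : Type*} [CommRing R] {p q : R[X]} (hp : p.Monic) {a : R}
    (h : C a ∣ p * q) : C a ∣ q := by
  have hz : ∀ r : R[X], C a ∣ r ↔ r.map (Ideal.Quotient.mk (Ideal.span {a})) = 0 := by
    intro r
    rw [C_dvd_iff_dvd_coeff, Polynomial.ext_iff]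
    simp only [coeff_map, coeff_zero, Ideal.Quotient.eq_zero_iff_mem, Ideal.mem_span_singleton]
  rw [hz] at h ⊢
  rw [Polynomial.map_mul] at h
  exact (hp.map _).mul_right_eq_zero_iff.1 h

theorem dvd_det_of_dvd_mulVec {n R : Type*} [Fintype n] [DecidableEq n] [CommRing R]
    {M : Matrix n n R} {v : n → R} {i : n} (hv : v i = 1) {a : R} (h : ∀ k, a ∣ M.mulVec v k) :
    a ∣ M.det := by
  have e : M.det = M.adjugate.mulVec (M.mulVec v) i := by
    rw [Matrix.mulVec_mulVec, Matrix.adjugate_mul, Matrix.smul_mulVec, Matrix.one_mulVec,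
      Pi.smul_apply, hv, smul_eq_mul, mul_one]
  rw [e]
  exact Finset.dvd_sum fun k _ => (h k).mul_left _

/-- The solutions for the first coordinate of the equations of the hyperplanes `x₀ = s`,
`x₀ = x_l + t` and `x₀ = -x_l + t` with `s ∈ S` and `t ∈ T`. -/
def hyperplaneRoot (S T : Finset ℂ) (n : ℕ) :
    S ⊕ (Fin n × Bool × T) → MvPolynomial (Fin n) ℂ
  | .inl s => MvPolynomial.C (s : ℂ)
  | .inr (l, b, t) =>
    (if b then MvPolynomial.X l else -MvPolynomial.X l) + MvPolynomial.C (t : ℂ)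

theorem hyperplaneRoot_injective (S T : Finset ℂ) (n : ℕ) :
    Function.Injective (hyperplaneRoot S T n) := by
  have h1 : (1 : ℂ) ≠ -1 := by norm_num
  have h2 : (-1 : ℂ) ≠ 1 := by norm_num
  intro a b hab
  have h0 := congrArg (MvPolynomial.eval (0 : Fin n → ℂ)) hab
  have h := fun l => congrArg (MvPolynomial.eval (Pi.single l (1 : ℂ))) hab
  clear hab
  rcases a with ⟨s, hs⟩ | ⟨l, b₁, t, ht⟩ <;> rcases b with ⟨s', hs'⟩ | ⟨l', b₂, t', ht'⟩
  · simpa [hyperplaneRoot] using h0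
  · replace h := h l'
    cases b₂ <;> simp_all [hyperplaneRoot]
  · replace h := h l
    cases b₁ <;> simp_all [hyperplaneRoot]
  · replace h := h l
    by_cases hl : l = l'
    · subst hl
      cases b₁ <;> cases b₂ <;> simp_all [hyperplaneRoot]
    · cases b₁ <;> cases b₂ <;> simp_all [hyperplaneRoot, Ne.symm hl]

/-- The product of the equations of the hyperplanes in `hyperplaneRoot`. -/
def hyperplaneProd (S T : Finset ℂ) (n : ℕ) : (MvPolynomial (Fin n) ℂ)[X] :=
  ∏ a, (X - C (hyperplaneRoot S T n a))

theorem hyperplaneProd_monic (S T : Finset ℂ) (n : ℕ) : (hyperplaneProd S T n).Monic :=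
  monic_prod_of_monic _ _ fun _ _ => monic_X_sub_C _

theorem natDegree_hyperplaneProd (S T : Finset ℂ) (n : ℕ) :
    (hyperplaneProd S T n).natDegree = S.card + n * (2 * T.card) := by
  rw [hyperplaneProd, natDegree_prod_of_monic _ _ fun _ _ => monic_X_sub_C _]
  simp

theorem hyperplaneProd_dvd {S T : Finset ℂ} {n : ℕ} {p : (MvPolynomial (Fin n) ℂ)[X]}
    (h : ∀ a, X - C (hyperplaneRoot S T n a) ∣ p) : hyperplaneProd S T n ∣ p := by
  refine Finset.prod_dvd_of_isRelPrime (fun a _ b _ hab => ?_) fun a _ => h a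
  refine ((irreducible_X_sub_C _).isRelPrime_iff_not_dvd).2 fun hd => hab ?_
  rw [dvd_iff_isRoot, IsRoot, eval_sub, eval_X, eval_C, sub_eq_zero] at hd
  exact hyperplaneRoot_injective S T n hd

/-- The defining polynomial of the arrangement of the hyperplanes `x_i = s`, `x_i - x_j = t` and
`x_i + x_j = t` with `s ∈ S`, `t ∈ T` and `i < j`. -/
def arrangementPoly (S T : Finset ℂ) : (N : ℕ) → MvPolynomial (Fin N) ℂ
  | 0 => 1
  | n + 1 => (MvPolynomial.finSuccEquiv ℂ n).symm (hyperplaneProd S T n * C (arrangementPoly S T n))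

theorem arrangementPoly_ne_zero (S T : Finset ℂ) (N : ℕ) : arrangementPoly S T N ≠ 0 := by
  induction N with
  | zero => exact one_ne_zero
  | succ n ih =>
    rw [arrangementPoly, ne_eq, EmbeddingLike.map_eq_zero_iff]
    exact mul_ne_zero (hyperplaneProd_monic S T n).ne_zero (C_ne_zero.2 ih)

theorem finSuccEquiv_algebraMap (n : ℕ) (c : ℂ) :
    MvPolynomial.finSuccEquiv ℂ n (MvPolynomial.C c) = C (MvPolynomial.C c) := by
  rw [← MvPolynomial.algebraMap_eq, AlgEquiv.commutes]
  rfl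

theorem arrangementPoly_dvd {S T : Finset ℂ} {N : ℕ} {g : MvPolynomial (Fin N) ℂ}
    (h₁ : ∀ i, ∀ s ∈ S, MvPolynomial.X i - MvPolynomial.C s ∣ g)
    (h₂ : ∀ i j, i < j → ∀ t ∈ T, MvPolynomial.X i - MvPolynomial.X j - MvPolynomial.C t ∣ g)
    (h₃ : ∀ i j, i < j → ∀ t ∈ T, MvPolynomial.X i + MvPolynomial.X j - MvPolynomial.C t ∣ g) :
    arrangementPoly S T N ∣ g := by
  induction N with
  | zero => exact one_dvd _
  | succ n ih =>
    have hM : hyperplaneProd S T n ∣ MvPolynomial.finSuccEquiv ℂ n g := by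
      refine hyperplaneProd_dvd ?_
      rintro (⟨s, hs⟩ | ⟨l, b, t, ht⟩)
      · have h := _root_.map_dvd (MvPolynomial.finSuccEquiv ℂ n) (h₁ 0 s hs)
        rwa [map_sub, MvPolynomial.finSuccEquiv_X_zero, finSuccEquiv_algebraMap] at h
      · cases b
        · have h := _root_.map_dvd (MvPolynomial.finSuccEquiv ℂ n) (h₃ 0 l.succ (Fin.succ_pos l) t ht)
          rw [map_sub, map_add, MvPolynomial.finSuccEquiv_X_zero, MvPolynomial.finSuccEquiv_X_succ,
            finSuccEquiv_algebraMap] at h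
          refine (dvd_of_eq ?_).trans h
          simp only [hyperplaneRoot, C_add, C_neg, Bool.false_eq_true, if_false]
          ring
        · have h := _root_.map_dvd (MvPolynomial.finSuccEquiv ℂ n) (h₂ 0 l.succ (Fin.succ_pos l) t ht)
          rw [map_sub, map_sub, MvPolynomial.finSuccEquiv_X_zero, MvPolynomial.finSuccEquiv_X_succ,
            finSuccEquiv_algebraMap] at h
          refine (dvd_of_eq ?_).trans h
          simp only [hyperplaneRoot, C_add, if_true]
          ring
    obtain ⟨q, hq⟩ := hM
    have hcoeff : ∀ {a : MvPolynomial (Fin n) ℂ} {b : MvPolynomial (Fin (n + 1)) ℂ},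
        MvPolynomial.finSuccEquiv ℂ n b = C a → b ∣ g → ∀ k, a ∣ q.coeff k := by
      intro a b hab hb
      have h := _root_.map_dvd (MvPolynomial.finSuccEquiv ℂ n) hb
      rw [hab, hq] at h
      exact (C_dvd_iff_dvd_coeff _ _).1 (C_dvd_of_dvd_monic_mul (hyperplaneProd_monic S T n) h)
    have hQ : C (arrangementPoly S T n) ∣ q := by
      rw [C_dvd_iff_dvd_coeff]
      intro k
      refine ih (fun i s hs => hcoeff ?_ (h₁ i.succ s hs) k)
        (fun i j hij t ht => hcoeff ?_ (h₂ _ _ (Fin.succ_lt_succ_iff.2 hij) t ht) k)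
        (fun i j hij t ht => hcoeff ?_ (h₃ _ _ (Fin.succ_lt_succ_iff.2 hij) t ht) k)
      all_goals simp only [map_sub, map_add, MvPolynomial.finSuccEquiv_X_succ,
        finSuccEquiv_algebraMap]
    have h := _root_.map_dvd (MvPolynomial.finSuccEquiv ℂ n).symm (mul_dvd_mul_left (hyperplaneProd S T n) hQ)
    rwa [← hq, AlgEquiv.symm_apply_apply] at h

/-- The logarithmic vector fields of the arrangement of the hyperplanes `x_i = s`, `x_i - x_j = t`
and `x_i + x_j = t` with `s ∈ S`, `t ∈ T` and `i < j`. -/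
structure IsLogarithmic (S T : Finset ℂ) {N : ℕ} (f : Fin N → MvPolynomial (Fin N) ℂ) : Prop where
  dvd_apply : ∀ i, ∀ s ∈ S, MvPolynomial.X i - MvPolynomial.C s ∣ f i
  dvd_sub : ∀ i j, i < j → ∀ t ∈ T,
    MvPolynomial.X i - MvPolynomial.X j - MvPolynomial.C t ∣ f i - f j
  dvd_add : ∀ i j, i < j → ∀ t ∈ T,
    MvPolynomial.X i + MvPolynomial.X j - MvPolynomial.C t ∣ f i + f j

theorem IsLogarithmic.arrangementPoly_dvd_det {S T : Finset ℂ} {N : ℕ}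
    {M : Matrix (Fin N) (Fin N) (MvPolynomial (Fin N) ℂ)} (hM : ∀ k, IsLogarithmic S T (M k)) :
    arrangementPoly S T N ∣ M.det := by
  refine arrangementPoly_dvd (fun i s hs => ?_) (fun i j hij t ht => ?_) fun i j hij t ht => ?_
  · refine dvd_det_of_dvd_mulVec (v := Pi.single i 1) (i := i) (by simp) fun k => ?_
    simpa using (hM k).dvd_apply i s hs
  · refine dvd_det_of_dvd_mulVec (v := Pi.single i 1 - Pi.single j 1) (i := i)
      (by simp [hij.ne]) fun k => ?_
    simpa [Matrix.mulVec_sub] using (hM k).dvd_sub i j hij t ht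
  · refine dvd_det_of_dvd_mulVec (v := Pi.single i 1 + Pi.single j 1) (i := i)
      (by simp [hij.ne]) fun k => ?_
    simpa [Matrix.mulVec_add] using (hM k).dvd_add i j hij t ht

/-- Saito's criterion: logarithmic vector fields whose determinant is the defining polynomial of
the arrangement span all logarithmic vector fields. -/
theorem IsLogarithmic.exists_eq_sum {S T : Finset ℂ} {N : ℕ}
    {M : Matrix (Fin N) (Fin N) (MvPolynomial (Fin N) ℂ)} (hM : ∀ k, IsLogarithmic S T (M k))
    {c : ℂ} (hc : c ≠ 0) (hdet : M.det = MvPolynomial.C c * arrangementPoly S T N)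
    {f : Fin N → MvPolynomial (Fin N) ℂ} (hf : IsLogarithmic S T f) :
    ∃ a : Fin N → MvPolynomial (Fin N) ℂ, ∀ i, f i = ∑ k, a k * M k i := by
  have hd : ∀ k, arrangementPoly S T N ∣ M.transpose.cramer f k := by
    intro k
    rw [Matrix.cramer_transpose_apply]
    refine arrangementPoly_dvd_det fun l => ?_
    by_cases hl : l = k
    · subst hl
      rwa [Matrix.updateRow_self]
    · rw [Matrix.updateRow_ne hl]
      exact hM l
  choose d hd using hd
  refine ⟨fun k => MvPolynomial.C c⁻¹ * d k, fun i => ?_⟩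
  have h := congrFun (Matrix.mulVec_cramer M.transpose f) i
  rw [Matrix.det_transpose, hdet, Pi.smul_apply, smul_eq_mul, Matrix.mulVec, dotProduct] at h
  simp only [hd, Matrix.transpose_apply] at h
  have hcc : (MvPolynomial.C c⁻¹ * MvPolynomial.C c : MvPolynomial (Fin N) ℂ) = 1 := by
    rw [← MvPolynomial.C_mul, inv_mul_cancel₀ hc, MvPolynomial.C_1]
  refine mul_left_cancel₀ (arrangementPoly_ne_zero S T N) ?_
  rw [Finset.mul_sum]
  calc arrangementPoly S T N * f i
      = MvPolynomial.C c⁻¹ * (MvPolynomial.C c * arrangementPoly S T N * f i) := by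
        linear_combination (-(arrangementPoly S T N * f i)) * hcc
    _ = _ := by
        rw [← h, Finset.mul_sum]
        exact Finset.sum_congr rfl fun k _ => by ring

/-- The negatives of the zeros of `centredProd n₁ * centredProd n₂`. -/
def shortConstants (n₁ n₂ : ℕ) : Finset ℂ :=
  (Finset.range n₁).image (fun r : ℕ => (r : ℂ) - ((n₁ : ℂ) - 1) / 2) ∪
    (Finset.range n₂).image (fun r : ℕ => (r : ℂ) - ((n₂ : ℂ) - 1) / 2)

/-- The integers of absolute value at most `m`, as complex numbers. -/
def longConstants (m : ℕ) : Finset ℂ :=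
  (Finset.Icc (-(m : ℤ)) m).image (fun r : ℤ => (r : ℂ))

theorem card_shortConstants {n₁ n₂ : ℕ} (hn : Odd (n₁ + n₂)) :
    (shortConstants n₁ n₂).card = n₁ + n₂ := by
  have hinj : ∀ n : ℕ, Function.Injective fun r : ℕ => (r : ℂ) - ((n : ℂ) - 1) / 2 := fun n r r' h =>
    Nat.cast_injective (sub_left_injective h)
  rw [shortConstants, Finset.card_union_of_disjoint, Finset.card_image_of_injective _ (hinj n₁),
    Finset.card_image_of_injective _ (hinj n₂), Finset.card_range, Finset.card_range]
  rw [Finset.disjoint_left]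
  intro s hs hs'
  obtain ⟨r, -, rfl⟩ := Finset.mem_image.1 hs
  obtain ⟨r', -, h⟩ := Finset.mem_image.1 hs'
  have h' : (2 * r' + n₁ : ℂ) = 2 * r + n₂ := by linear_combination 2 * h
  have h'' : 2 * r' + n₁ = 2 * r + n₂ := by exact_mod_cast h'
  obtain ⟨a, ha⟩ := hn
  omega

theorem card_longConstants (m : ℕ) : (longConstants m).card = 2 * m + 1 := by
  rw [longConstants, Finset.card_image_of_injective _ Int.cast_injective, Int.card_Icc]
  omega

theorem sub_dvd_centredProd_mul {A : Type*} [CommRing A] [Algebra ℂ A] {n₁ n₂ : ℕ} {s : ℂ}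
    (hs : s ∈ shortConstants n₁ n₂) (x : A) :
    x - algebraMap ℂ A s ∣ centredProd n₁ x * centredProd n₂ x := by
  have key : ∀ n r : ℕ, r < n → x - algebraMap ℂ A (r - ((n : ℂ) - 1) / 2) ∣ centredProd n x := by
    intro n r hr
    refine (dvd_of_eq ?_).trans (Finset.dvd_prod_of_mem _ (Finset.mem_range.2 hr))
    rw [sub_eq_add_neg, ← map_neg]
    congr 2
    ring
  rw [shortConstants, Finset.mem_union, Finset.mem_image, Finset.mem_image] at hs
  rcases hs with ⟨r, hr, rfl⟩ | ⟨r, hr, rfl⟩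
  · exact (key _ _ (Finset.mem_range.1 hr)).mul_right _
  · exact (key _ _ (Finset.mem_range.1 hr)).mul_left _

theorem catalanField_isLogarithmic {n₁ n₂ : ℕ} (hn : Odd (n₁ + n₂)) (m : ℕ) {N : ℕ} (k : ℕ) :
    IsLogarithmic (shortConstants n₁ n₂) (longConstants m)
      (catalanField n₁ n₂ m (MvPolynomial.X : Fin N → MvPolynomial (Fin N) ℂ) k) := by
  refine ⟨fun i s hs => ?_, fun i j hij t ht => ?_, fun i j hij t ht => ?_⟩
  · exact (sub_dvd_centredProd_mul hs _).trans (dvd_discreteIntegral _ _ _ _ _)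
  · obtain ⟨l, hl, rfl⟩ := Finset.mem_image.1 ht
    rw [Finset.mem_Icc] at hl
    rw [← Ideal.mem_span_singleton, ← Ideal.Quotient.eq_zero_iff_mem]
    set I := Ideal.span {(MvPolynomial.X i - MvPolynomial.X j - MvPolynomial.C (l : ℂ) :
      MvPolynomial (Fin N) ℂ)} with hI
    have h : Ideal.Quotient.mkₐ ℂ I (MvPolynomial.X i) =
        Ideal.Quotient.mkₐ ℂ I (MvPolynomial.X j) + algebraMap ℂ _ (l : ℂ) := by
      rw [← AlgHom.commutes (Ideal.Quotient.mkₐ ℂ I), ← map_add, ← sub_eq_zero, ← map_sub]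
      refine Ideal.Quotient.eq_zero_iff_mem.2 ?_
      rw [← sub_sub]
      exact Ideal.mem_span_singleton_self _
    have h' := catalanField_eq_of_eq_add_intCast hn hij.ne hl.1 hl.2
      (x := fun r => Ideal.Quotient.mkₐ ℂ I (MvPolynomial.X r)) h k
    rw [← map_catalanField, ← map_catalanField, ← sub_eq_zero, ← map_sub] at h'
    exact h'
  · obtain ⟨l, hl, rfl⟩ := Finset.mem_image.1 ht
    rw [Finset.mem_Icc] at hl
    rw [← Ideal.mem_span_singleton, ← Ideal.Quotient.eq_zero_iff_mem]
    set I := Ideal.span {(MvPolynomial.X i + MvPolynomial.X j - MvPolynomial.C (l : ℂ) :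
      MvPolynomial (Fin N) ℂ)} with hI
    have h : Ideal.Quotient.mkₐ ℂ I (MvPolynomial.X i) =
        -Ideal.Quotient.mkₐ ℂ I (MvPolynomial.X j) + algebraMap ℂ _ (l : ℂ) := by
      rw [← AlgHom.commutes (Ideal.Quotient.mkₐ ℂ I), ← map_neg, ← map_add, ← sub_eq_zero, ← map_sub]
      refine Ideal.Quotient.eq_zero_iff_mem.2 ?_
      rw [← sub_sub, sub_neg_eq_add]
      exact Ideal.mem_span_singleton_self _
    have h' := catalanField_eq_neg_of_eq_neg_add_intCast hn hij.ne hl.1 hl.2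
      (x := fun r => Ideal.Quotient.mkₐ ℂ I (MvPolynomial.X r)) h k
    rw [← map_catalanField, ← map_catalanField, ← sub_eq_zero, sub_neg_eq_add, ← map_add] at h'
    exact h'

theorem det_catalanField {n₁ n₂ : ℕ} (hn : Odd (n₁ + n₂)) (m N : ℕ) :
    ∃ c : ℂ, c ≠ 0 ∧
      (Matrix.of fun (k : Fin N) i => catalanField n₁ n₂ m
        (MvPolynomial.X : Fin N → MvPolynomial (Fin N) ℂ) (k : ℕ) i).det =
      MvPolynomial.C c * arrangementPoly (shortConstants n₁ n₂) (longConstants m) N := by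
  induction N with
  | zero => exact ⟨1, one_ne_zero, by simp [arrangementPoly]⟩
  | succ n ih =>
    obtain ⟨c, hc, ih⟩ := ih
    obtain ⟨u, hu⟩ := IsLogarithmic.arrangementPoly_dvd_det
      (M := Matrix.of fun (k : Fin (n + 1)) i => catalanField n₁ n₂ m
        (MvPolynomial.X : Fin (n + 1) → MvPolynomial (Fin (n + 1)) ℂ) (k : ℕ) i)
      fun k => catalanField_isLogarithmic hn m (k : ℕ)
    set P := hyperplaneProd (shortConstants n₁ n₂) (longConstants m) n
    set Q := arrangementPoly (shortConstants n₁ n₂) (longConstants m) n with hQ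
    have hQ0 : Q ≠ 0 := arrangementPoly_ne_zero _ _ _
    have hX : (fun j => MvPolynomial.finSuccEquiv ℂ n (MvPolynomial.X j)) =
        (Fin.cons X fun j => C (MvPolynomial.X j) : Fin (n + 1) → (MvPolynomial (Fin n) ℂ)[X]) := by
      funext j
      refine Fin.cases ?_ (fun j => ?_) j
      · rw [MvPolynomial.finSuccEquiv_X_zero, Fin.cons_zero]
      · rw [MvPolynomial.finSuccEquiv_X_succ, Fin.cons_succ]
    have hdet : MvPolynomial.finSuccEquiv ℂ n (Matrix.of fun (k : Fin (n + 1)) i =>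
        catalanField n₁ n₂ m (MvPolynomial.X : Fin (n + 1) → MvPolynomial (Fin (n + 1)) ℂ)
          (k : ℕ) i).det =
        (Matrix.of fun (k : Fin (n + 1)) i => catalanField n₁ n₂ m
          (Fin.cons X fun j => C (MvPolynomial.X j) : Fin (n + 1) → (MvPolynomial (Fin n) ℂ)[X])
          (k : ℕ) i).det := by
      rw [AlgEquiv.map_det, ← hX]
      congr 1
      ext1 k i
      exact map_catalanField (MvPolynomial.finSuccEquiv ℂ n).toAlgHom n₁ n₂ m _ _ _
    obtain ⟨hd, hcoeff⟩ := det_catalanField_cons n₁ n₂ m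
      (MvPolynomial.X : Fin n → MvPolynomial (Fin n) ℂ)
    rw [← hdet, hu, ih] at hcoeff
    rw [← hdet, hu] at hd
    set b : ℂ := (-1) ^ n * oddBeta m ((n₁ : ℤ) + n₂ - 2 * m + 2 * (m * n + n : ℕ)) * ((-1) ^ m) ^ n
    have hb0 : b ≠ 0 := by
      refine mul_ne_zero (mul_ne_zero (pow_ne_zero _ (by norm_num)) (oddBeta_ne_zero m ?_))
        (pow_ne_zero _ (pow_ne_zero _ (by norm_num)))
      obtain ⟨r, hr⟩ := hn
      exact ⟨r - m + (m * n + n : ℕ), by omega⟩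
    clear_value b
    have hP : P.Monic := hyperplaneProd_monic _ _ _
    have hPd : P.natDegree = n₁ + n₂ + 2 * (m * n + n) + n * (2 * m) := by
      rw [natDegree_hyperplaneProd, card_shortConstants hn, card_longConstants]
      ring
    obtain ⟨v, hv⟩ : ∃ v, v = MvPolynomial.finSuccEquiv ℂ n u := ⟨_, rfl⟩
    have hfac : MvPolynomial.finSuccEquiv ℂ n (arrangementPoly (shortConstants n₁ n₂)
        (longConstants m) (n + 1) * u) = P * (C Q * v) := by
      rw [map_mul, arrangementPoly, AlgEquiv.apply_symm_apply, hv, mul_assoc]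
    rw [hfac] at hd hcoeff
    have hv0 : v ≠ 0 := by
      rintro rfl
      rw [mul_zero, mul_zero, coeff_zero] at hcoeff
      refine mul_ne_zero ?_ (mul_ne_zero ?_ hQ0) hcoeff.symm
      · simpa using hb0
      · simpa using hc
    have hvd : v.natDegree ≤ 0 := by
      rw [hP.natDegree_mul' (mul_ne_zero (C_ne_zero.2 hQ0) hv0), natDegree_C_mul hQ0] at hd
      omega
    obtain ⟨w, hw⟩ : ∃ w, v = C w := ⟨_, eq_C_of_natDegree_le_zero hvd⟩
    rw [hw, ← C_mul, coeff_mul_C, ← hPd, coeff_natDegree, hP, one_mul] at hcoeff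
    have hwbc : w = MvPolynomial.C (b * c) := by
      refine mul_left_cancel₀ hQ0 (hcoeff.trans ?_)
      rw [MvPolynomial.algebraMap_eq, MvPolynomial.C_mul]
      ring
    refine ⟨b * c, mul_ne_zero hb0 hc, ?_⟩
    rw [hu, mul_comm]
    congr 1
    refine (MvPolynomial.finSuccEquiv ℂ n).injective ?_
    rw [← hv, hw, hwbc, finSuccEquiv_algebraMap]

end Polynomial.Catalan

open Polynomial.Catalan

theorem applyVF_X {n : ℕ} (f : Fin n → MvPolynomial (Fin n) ℂ) (r : Fin n) :
    applyVF f (MvPolynomial.X r) = f r := by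
  simp [applyVF, MvPolynomial.pderiv_X, Pi.single_apply]

theorem applyVF_C {n : ℕ} (f : Fin n → MvPolynomial (Fin n) ℂ) (a : ℂ) :
    applyVF f (MvPolynomial.C a) = 0 := by
  simp [applyVF]

theorem applyVF_add {n : ℕ} (f : Fin n → MvPolynomial (Fin n) ℂ) (p q : MvPolynomial (Fin n) ℂ) :
    applyVF f (p + q) = applyVF f p + applyVF f q := by
  simp [applyVF, mul_add, Finset.sum_add_distrib]

theorem applyVF_neg {n : ℕ} (f : Fin n → MvPolynomial (Fin n) ℂ) (p : MvPolynomial (Fin n) ℂ) :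
    applyVF f (-p) = -applyVF f p := by
  simp [applyVF]

theorem applyVF_mul {n : ℕ} (f : Fin n → MvPolynomial (Fin n) ℂ) (p q : MvPolynomial (Fin n) ℂ) :
    applyVF f (p * q) = p * applyVF f q + q * applyVF f p := by
  simp only [applyVF, Derivation.leibniz, smul_eq_mul, Finset.mul_sum, ← Finset.sum_add_distrib]
  exact Finset.sum_congr rfl fun i _ => by ring

theorem applyVF_sum_mul {n : ℕ} (c : Fin n → MvPolynomial (Fin n) ℂ)
    (η : Fin n → Fin n → MvPolynomial (Fin n) ℂ) (p : MvPolynomial (Fin n) ℂ) :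
    applyVF (fun i => ∑ k, c k * η k i) p = ∑ k, c k * applyVF (η k) p := by
  simp only [applyVF, Finset.sum_mul, Finset.mul_sum, mul_assoc]
  exact Finset.sum_comm

theorem applyVF_conj_eq {n : ℕ} {f : Fin n → MvPolynomial (Fin n) ℂ}
    {φ : MvPolynomial (Fin n) ℂ →ₐ[ℂ] MvPolynomial (Fin n) ℂ}
    (hφ : ∀ r, φ (φ (MvPolynomial.X r)) = MvPolynomial.X r)
    (h : ∀ r, φ (applyVF f (φ (MvPolynomial.X r))) = f r) (p : MvPolynomial (Fin n) ℂ) :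
    φ (applyVF f (φ p)) = applyVF f p := by
  have hφ' : ∀ p, φ (φ p) = p := fun p => by
    have : φ.comp φ = AlgHom.id ℂ _ := MvPolynomial.algHom_ext fun r => by simpa using hφ r
    exact DFunLike.congr_fun this p
  induction p using MvPolynomial.induction_on with
  | C a => rw [MvPolynomial.algHom_C, MvPolynomial.algebraMap_eq, applyVF_C, map_zero]
  | add p q hp hq => simp only [map_add, applyVF_add, hp, hq]
  | mul_X p r hp => simp only [map_mul, map_add, applyVF_mul, hp, h, hφ', applyVF_X]

theorem eq_of_conj_eq {n : ℕ} {η : Fin n → Fin n → MvPolynomial (Fin n) ℂ}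
    (hη : ∀ c : Fin n → MvPolynomial (Fin n) ℂ, (∀ i, ∑ k, c k * η k i = 0) → ∀ k, c k = 0)
    {φ : MvPolynomial (Fin n) ℂ →ₐ[ℂ] MvPolynomial (Fin n) ℂ}
    (h : ∀ k p, φ (applyVF (η k) (φ p)) = applyVF (η k) p) {f c : Fin n → MvPolynomial (Fin n) ℂ}
    (hf : ∀ p, φ (applyVF f (φ p)) = applyVF f p) (hc : ∀ i, f i = ∑ k, c k * η k i) (k : Fin n) :
    φ (c k) = c k := by
  refine sub_eq_zero.1 (hη (fun k => φ (c k) - c k) (fun i => ?_) k)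
  have hfi := hf (MvPolynomial.X i)
  have hf' : f = fun i => ∑ k, c k * η k i := funext hc
  rw [hf', applyVF_sum_mul, applyVF_sum_mul, map_sum] at hfi
  simp only [map_mul, h, applyVF_X] at hfi
  simp only [sub_mul, Finset.sum_sub_distrib, hfi, sub_self]

theorem BInvVF_catalanField {n₁ n₂ : ℕ} (hn : Odd (n₁ + n₂)) (m : ℕ) {N : ℕ} (k : ℕ) :
    BInvVF (catalanField n₁ n₂ m (MvPolynomial.X : Fin N → MvPolynomial (Fin N) ℂ) k) := by
  refine ⟨fun j => applyVF_conj_eq (fun r => ?_) fun r => ?_, fun i j hij =>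
    applyVF_conj_eq (fun r => ?_) fun r => ?_⟩
  · by_cases hr : r = j <;> simp [hr]
  · have hx : ∀ s : Fin N, MvPolynomial.aeval (fun k => if k = j then -(MvPolynomial.X j) else
        (MvPolynomial.X k : MvPolynomial (Fin N) ℂ)) (MvPolynomial.X s : MvPolynomial (Fin N) ℂ) =
        if s = j then -MvPolynomial.X s else MvPolynomial.X s := by
      intro s
      by_cases hs : s = j <;> simp [hs]
    have hx' : ∀ s : Fin N, (if s = j then -MvPolynomial.X s else MvPolynomial.X s :
        MvPolynomial (Fin N) ℂ) = MvPolynomial.X s ∨ (if s = j then -MvPolynomial.X s else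
          MvPolynomial.X s : MvPolynomial (Fin N) ℂ) = -MvPolynomial.X s := by
      intro s
      by_cases hs : s = j <;> simp [hs]
    rw [hx]
    split_ifs with hr
    · rw [applyVF_neg, applyVF_X, map_neg, map_catalanField]
      simp only [hx]
      rw [catalanField_of_eq_neg hn m hx' (if_pos hr), neg_neg]
    · rw [applyVF_X, map_catalanField]
      simp only [hx]
      rw [catalanField_of_eq n₁ n₂ m hx' (if_neg hr)]
  · by_cases hr : r = i
    · subst hr
      simp [hij.symm]
    · by_cases hr' : r = j
      · subst hr'
        simp [hr]
      · simp [hr, hr']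
  · have hx : ∀ s : Fin N, MvPolynomial.aeval (fun k => if k = i then MvPolynomial.X j
        else if k = j then MvPolynomial.X i else (MvPolynomial.X k : MvPolynomial (Fin N) ℂ))
        (MvPolynomial.X s : MvPolynomial (Fin N) ℂ) = MvPolynomial.X (Equiv.swap i j s) := by
      intro s
      rw [MvPolynomial.aeval_X, Equiv.swap_apply_def]
      split_ifs <;> rfl
    rw [hx, applyVF_X, map_catalanField]
    simp only [hx]
    rw [catalanField_comp_perm, Equiv.swap_apply_self]

theorem mem_DBCCat_iff {N m1 m2 m3 : ℕ} {f : Fin N → MvPolynomial (Fin N) ℂ} :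
    f ∈ DBCCat N m1 m2 m3 ↔
      IsLogarithmic (shortConstants (2 * m1 + 1) (2 * m2)) (longConstants m3) f := by
  have hu : IsUnit (MvPolynomial.C 2 : MvPolynomial (Fin N) ℂ) :=
    (isUnit_iff_ne_zero.2 (two_ne_zero' ℂ)).map MvPolynomial.C
  have hsub : ∀ (i : Fin N) (s t : ℂ) (g : MvPolynomial (Fin N) ℂ), t = 2 * s →
      (MvPolynomial.C 2 * MvPolynomial.X i - MvPolynomial.C t ∣ g ↔
        MvPolynomial.X i - MvPolynomial.C s ∣ g) := by
    rintro i s t g rfl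
    rw [MvPolynomial.C_mul, ← mul_sub, hu.mul_left_dvd]
  have hadd : ∀ (i : Fin N) (s t : ℂ) (g : MvPolynomial (Fin N) ℂ), t = -(2 * s) →
      (MvPolynomial.C 2 * MvPolynomial.X i + MvPolynomial.C t ∣ g ↔
        MvPolynomial.X i - MvPolynomial.C s ∣ g) := by
    rintro i s t g rfl
    rw [MvPolynomial.C_neg, ← sub_eq_add_neg, hsub i s _ g rfl]
  constructor
  · rintro ⟨h₁, h₂, h₃⟩
    refine ⟨fun i s hs => ?_, fun i j hij t ht => ?_, fun i j hij t ht => ?_⟩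
    · rw [shortConstants, Finset.mem_union, Finset.mem_image, Finset.mem_image] at hs
      rcases hs with ⟨r, hr, rfl⟩ | ⟨r, hr, rfl⟩
      · rw [Finset.mem_range] at hr
        have h := h₁ i ((r : ℤ) - m1) (by omega) (by omega)
        convert h using 3
        push_cast
        ring
      · rw [Finset.mem_range] at hr
        rcases le_or_gt m2 r with hle | hlt
        · obtain ⟨a, rfl⟩ := Nat.exists_eq_add_of_le hle
          refine (hsub i _ _ _ ?_).1 (h₂ i (a + 1) (by omega) (by omega)).1
          push_cast
          ring
        · obtain ⟨a, rfl⟩ := Nat.exists_eq_add_of_le hlt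
          refine (hadd i _ _ _ ?_).1 (h₂ i (a + 1) (by omega) (by omega)).2
          push_cast
          ring
    · obtain ⟨l, hl, rfl⟩ := Finset.mem_image.1 ht
      rw [Finset.mem_Icc] at hl
      exact (h₃ i j hij l hl.1 hl.2).1
    · obtain ⟨l, hl, rfl⟩ := Finset.mem_image.1 ht
      rw [Finset.mem_Icc] at hl
      exact (h₃ i j hij l hl.1 hl.2).2
  · intro h
    have hs₁ : ∀ r : ℕ, r < 2 * m1 + 1 → (r : ℂ) - (((2 * m1 + 1 : ℕ) : ℂ) - 1) / 2 ∈
        shortConstants (2 * m1 + 1) (2 * m2) := fun r hr =>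
      Finset.mem_union_left _ (Finset.mem_image_of_mem _ (Finset.mem_range.2 hr))
    have hs₂ : ∀ r : ℕ, r < 2 * m2 → (r : ℂ) - (((2 * m2 : ℕ) : ℂ) - 1) / 2 ∈
        shortConstants (2 * m1 + 1) (2 * m2) := fun r hr =>
      Finset.mem_union_right _ (Finset.mem_image_of_mem _ (Finset.mem_range.2 hr))
    have ht : ∀ l : ℤ, -(m3 : ℤ) ≤ l → l ≤ m3 → (l : ℂ) ∈ longConstants m3 := fun l hl hl' =>
      Finset.mem_image_of_mem _ (Finset.mem_Icc.2 ⟨hl, hl'⟩)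
    refine ⟨fun i j hj hj' => ?_, fun i j hj hj' => ?_, fun i j hij k hk hk' =>
      ⟨h.dvd_sub i j hij _ (ht k hk hk'), h.dvd_add i j hij _ (ht k hk hk')⟩⟩
    · obtain ⟨r, hr⟩ := Int.eq_ofNat_of_zero_le (show 0 ≤ j + m1 by omega)
      refine h.dvd_apply i _ ?_
      convert hs₁ r (by omega) using 1
      have hr' : (j : ℂ) + m1 = r := by exact_mod_cast hr
      rw [← hr']
      push_cast
      ring
    · obtain ⟨a, rfl⟩ := Nat.exists_eq_add_of_le hj
      obtain ⟨b, rfl⟩ := Nat.exists_eq_add_of_le hj'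
      refine ⟨(hsub i _ _ _ ?_).2 (h.dvd_apply i _ (hs₂ (2 * a + 1 + b) (by omega))),
        (hadd i _ _ _ ?_).2 (h.dvd_apply i _ (hs₂ b (by omega)))⟩
      · push_cast
        ring
      · push_cast
        ring

/-- the extended Catalan arrangement `BCCat` of type `BC_N` is free:
`D(BCCat)` is a free `ℂ[x_1,…,x_N]`-module of rank `N`, and `D(BCCat)^W` is a free module
of rank `N` over `ℂ[x_1,…,x_N]^{W(B_N)}`. -/
theorem stmt_18 (N : ℕ) (hN : 2 ≤ N) (m1 m2 m3 : ℕ) :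
    -- `D(BCCat)` is free of rank `N` over `ℂ[x]`
    (∃ θ : Fin N → (Fin N → MvPolynomial (Fin N) ℂ),
      (∀ k, θ k ∈ DBCCat N m1 m2 m3) ∧
      (∀ f ∈ DBCCat N m1 m2 m3,
        ∃ c : Fin N → MvPolynomial (Fin N) ℂ, ∀ i, f i = ∑ k, c k * θ k i) ∧
      (∀ c : Fin N → MvPolynomial (Fin N) ℂ,
        (∀ i, (∑ k, c k * θ k i) = 0) → ∀ k, c k = 0)) ∧
    -- `D(BCCat)^{W(B_N)}` is free of rank `N` over the invariant ring
    (∃ η : Fin N → (Fin N → MvPolynomial (Fin N) ℂ),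
      (∀ k, η k ∈ DBCCat N m1 m2 m3 ∧ BInvVF (η k)) ∧
      (∀ f ∈ DBCCat N m1 m2 m3, BInvVF f →
        ∃ c : Fin N → MvPolynomial (Fin N) ℂ,
          (∀ k, BInv (c k)) ∧ ∀ i, f i = ∑ k, c k * η k i) ∧
      (∀ c : Fin N → MvPolynomial (Fin N) ℂ, (∀ k, BInv (c k)) →
        (∀ i, (∑ k, c k * η k i) = 0) → ∀ k, c k = 0)) := by
  have hn : Odd (2 * m1 + 1 + 2 * m2) := ⟨m1 + m2, by ring⟩
  let θ : Fin N → Fin N → MvPolynomial (Fin N) ℂ := fun k =>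
    catalanField (2 * m1 + 1) (2 * m2) m3 MvPolynomial.X (k : ℕ)
  have hlog : ∀ k, IsLogarithmic (shortConstants (2 * m1 + 1) (2 * m2)) (longConstants m3) (θ k) :=
    fun k => catalanField_isLogarithmic hn m3 (k : ℕ)
  have hmem : ∀ k, θ k ∈ DBCCat N m1 m2 m3 := fun k => mem_DBCCat_iff.2 (hlog k)
  obtain ⟨c, hc, hdet⟩ := det_catalanField hn m3 N
  have hspan : ∀ f ∈ DBCCat N m1 m2 m3,
      ∃ a : Fin N → MvPolynomial (Fin N) ℂ, ∀ i, f i = ∑ k, a k * θ k i := fun f hf =>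
    IsLogarithmic.exists_eq_sum (M := Matrix.of θ) hlog hc hdet (mem_DBCCat_iff.1 hf)
  have hindep : ∀ a : Fin N → MvPolynomial (Fin N) ℂ,
      (∀ i, (∑ k, a k * θ k i) = 0) → ∀ k, a k = 0 := fun a ha k => by
    have hdet0 : (Matrix.of θ).det ≠ 0 := by
      refine (hdet : (Matrix.of θ).det = _) ▸ mul_ne_zero ?_ (arrangementPoly_ne_zero _ _ _)
      exact (map_ne_zero_iff _ (MvPolynomial.C_injective _ _)).2 hc
    exact congrFun (Matrix.eq_zero_of_vecMul_eq_zero hdet0 (funext ha)) k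
  have hinv : ∀ k, BInvVF (θ k) := fun k => BInvVF_catalanField hn m3 (k : ℕ)
  refine ⟨⟨θ, hmem, hspan, hindep⟩, θ, fun k => ⟨hmem k, hinv k⟩, fun f hf hf' => ?_,
    fun a _ ha => hindep a ha⟩
  obtain ⟨a, ha⟩ := hspan f hf
  exact ⟨a, fun k => ⟨fun j => eq_of_conj_eq hindep (fun l => (hinv l).1 j) (hf'.1 j) ha k,
    fun i j hij => eq_of_conj_eq hindep (fun l => (hinv l).2 i j hij) (hf'.2 i j hij) ha k⟩, ha⟩

end
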